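/- arXiv:1804.03192 — 6 statements merged into one kernel-verified Lean document; each statement's English description precedes it below -/
import Mathlib

section
/- There exists an absolute constant C such that for every odd prime p, every natural number n, and every injection f : (Z/2Z)^n → Z/pZ, the probability over uniform independent x, y ∈ (Z/2Z)^n that f(x+y) = f(x) + f(y) is at most C · 2^{−n/11}. -/
open Finset

/-- Weighted count of configurations sharing a row and a column, for a 0/1 matrix. -/
lemma aux_path {V : Type*} [Fintype V] [AddCommGroup V] [Nonempty V]
    (hV : ∀ x : V, x + x = 0) (h : V → V → ℝ)
    (h0 : ∀ a b, h a b = 0 ∨ h a b = 1) (T : ℝ) (hT : ∑ a, ∑ b, h a b = T) :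
    T ^ 3 / (Fintype.card V : ℝ) ^ 2 ≤
      ∑ a, ∑ b, h a b * (∑ b', h a b') * (∑ b', h (a + b + b') b') := by
  classical
  have hnn : ∀ a b, 0 ≤ h a b := fun a b => by rcases h0 a b with h | h <;> rw [h] <;> norm_num
  set N : ℝ := (Fintype.card V : ℝ) with hN
  have hNpos : 0 < N := by rw [hN]; exact_mod_cast Fintype.card_pos
  set R : V → ℝ := fun a => ∑ b', h a b' with hR
  set C : V → ℝ := fun c => ∑ b', h (c + b') b' with hC
  have hT0 : 0 ≤ T := by
    rw [← hT]; exact sum_nonneg fun a _ => sum_nonneg fun b _ => hnn a b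
  have hcancel : ∀ a b : V, a + b + b = a := fun a b => by rw [add_assoc, hV, add_zero]
  have key : ∀ a b, 3 * (T / N) ^ 2 * h a b ≤
      h a b * R a * C (a + b) + (T / N) ^ 3 * (h a b * (R a)⁻¹)
        + (T / N) ^ 3 * (h a b * (C (a + b))⁻¹) := by
    intro a b
    rcases h0 a b with hab | hab
    · rw [hab]; simp
    · have h1 : 0 < R a := by
        have : h a b ≤ R a := single_le_sum (f := fun b => h a b) (fun i _ => hnn a i) (mem_univ b)
        linarith
      have h2 : 0 < C (a + b) := by
        have : h (a + b + b) b ≤ C (a + b) :=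
          single_le_sum (f := fun b' => h (a + b + b') b') (fun i _ => hnn _ i) (mem_univ b)
        rw [hcancel] at this
        linarith
      rw [hab]
      generalize R a = r at *
      generalize C (a + b) = c at *
      have ht : 0 ≤ T / N := by positivity
      generalize T / N = t at *
      have : 0 ≤ (r * c) ^ 2 + t ^ 3 * c + t ^ 3 * r - 3 * t ^ 2 * (r * c) := by
        obtain ⟨s, hs, hs2⟩ : ∃ s : ℝ, 0 ≤ s ∧ s ^ 2 = r * c :=
          ⟨√(r * c), Real.sqrt_nonneg _, Real.sq_sqrt (by positivity)⟩
        have hrc : 2 * s ≤ r + c := by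
          apply le_of_pow_le_pow_left₀ (n := 2) (by norm_num) (by positivity)
          nlinarith [sq_nonneg (r - c)]
        rw [← hs2]
        have h3 : t ^ 3 * (2 * s) ≤ t ^ 3 * (r + c) := by gcongr
        have h4 : 0 ≤ s * ((s - t) ^ 2 * (s + 2 * t)) := by positivity
        nlinarith [h3, h4]
      have e : 1 * r * c + t ^ 3 * (1 * r⁻¹) + t ^ 3 * (1 * c⁻¹) - 3 * t ^ 2 * 1
          = ((r * c) ^ 2 + t ^ 3 * c + t ^ 3 * r - 3 * t ^ 2 * (r * c)) / (r * c) := by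
        field_simp
      have : 0 ≤ ((r * c) ^ 2 + t ^ 3 * c + t ^ 3 * r - 3 * t ^ 2 * (r * c)) / (r * c) := by
        positivity
      linarith
  have hsumR : ∑ a, ∑ b, h a b * (R a)⁻¹ ≤ N := by
    calc ∑ a, ∑ b, h a b * (R a)⁻¹ = ∑ a, R a * (R a)⁻¹ := by
          refine sum_congr rfl fun a _ => ?_
          rw [← sum_mul]
      _ ≤ ∑ a : V, (1 : ℝ) := sum_le_sum fun a _ => mul_inv_le_one
      _ = N := by simp [hN]
  have hsumC : ∑ a, ∑ b, h a b * (C (a + b))⁻¹ ≤ N := by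
    calc ∑ a, ∑ b, h a b * (C (a + b))⁻¹ = ∑ b, ∑ a, h a b * (C (a + b))⁻¹ := sum_comm
      _ = ∑ b, ∑ c, h (c + b) b * (C c)⁻¹ := by
          refine sum_congr rfl fun b _ => ?_
          refine Fintype.sum_equiv (Equiv.addRight b) _ _ fun a => ?_
          simp [hcancel]
      _ = ∑ c, ∑ b, h (c + b) b * (C c)⁻¹ := sum_comm
      _ = ∑ c, C c * (C c)⁻¹ := by
          refine sum_congr rfl fun a _ => ?_
          rw [← sum_mul]
      _ ≤ ∑ a : V, (1 : ℝ) := sum_le_sum fun a _ => mul_inv_le_one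
      _ = N := by simp [hN]
  have hs := sum_le_sum fun a (_ : a ∈ univ) => sum_le_sum fun b (_ : b ∈ univ) => key a b
  simp only [sum_add_distrib, ← mul_sum] at hs
  rw [hT] at hs
  have ht : 0 ≤ (T / N) ^ 3 := by positivity
  have h1 := mul_le_mul_of_nonneg_left hsumR ht
  have h2 := mul_le_mul_of_nonneg_left hsumC ht
  have e1 : (T / N) ^ 3 * N = T ^ 3 / N ^ 2 := by field_simp
  have e2 : 3 * (T / N) ^ 2 * T = 3 * (T ^ 3 / N ^ 2) := by field_simp
  rw [e1] at h1 h2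
  rw [e2] at hs
  change _ ≤ ∑ a, ∑ b, h a b * R a * C (a + b)
  linarith

/-- Lower bound for the number of five-cycles. -/
lemma aux_lower {V : Type*} [Fintype V] [AddCommGroup V] [Nonempty V]
    (hV : ∀ x : V, x + x = 0) (g : V → V → ℝ)
    (g0 : ∀ a b, g a b = 0 ∨ g a b = 1) (T : ℝ) (hT : ∑ a, ∑ b, g a b = T) :
    T ^ 6 / (Fintype.card V : ℝ) ^ 7 ≤
      ∑ u, ∑ a, ∑ b, (g u b * g a b) * (∑ b', g u b' * g a b') *
        (∑ b', g u b' * g (a + b + b') b') := by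
  set N : ℝ := (Fintype.card V : ℝ) with hN
  have hNpos : 0 < N := by rw [hN]; exact_mod_cast Fintype.card_pos
  have gnn : ∀ a b, 0 ≤ g a b := fun a b => by rcases g0 a b with h | h <;> rw [h] <;> norm_num
  have h1 : ∀ u, (∑ a, ∑ b, g u b * g a b) ^ 3 / N ^ 2 ≤ ∑ a, ∑ b, (g u b * g a b) *
      (∑ b', g u b' * g a b') * (∑ b', g u b' * g (a + b + b') b') := fun u =>
    aux_path hV (fun a b => g u b * g a b) (fun a b => by
      rcases g0 u b with h | h <;> rcases g0 a b with h' | h' <;> simp [h, h']) _ rfl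
  refine le_trans ?_ (sum_le_sum fun u _ => h1 u)
  rw [← sum_div]
  have h2 := pow_sum_div_card_le_sum_pow (s := (univ : Finset V))
    (f := fun u => ∑ a, ∑ b, g u b * g a b) 
    (fun u _ => sum_nonneg fun a _ => sum_nonneg fun b _ => mul_nonneg (gnn _ _) (gnn _ _)) 2
  rw [card_univ, ← hN] at h2
  have h3 : T ^ 2 / N ≤ ∑ u, ∑ a, ∑ b, g u b * g a b := by
    have e : ∑ u, ∑ a, ∑ b, g u b * g a b = ∑ b, (∑ a, g a b) ^ 2 := by
      calc ∑ u, ∑ a, ∑ b, g u b * g a b = ∑ u, ∑ b, ∑ a, g u b * g a b :=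
            sum_congr rfl fun u _ => sum_comm
        _ = ∑ b, ∑ u, ∑ a, g u b * g a b := sum_comm
        _ = _ := sum_congr rfl fun b _ => by rw [sq, sum_mul_sum]
    rw [e]
    have := pow_sum_div_card_le_sum_pow (s := (univ : Finset V))
      (f := fun b => ∑ a, g a b) (fun b _ => sum_nonneg fun a _ => gnn _ _) 1
    rw [sum_comm, hT, card_univ, ← hN] at this
    simpa using this
  have h4 : (T ^ 2 / N) ^ 3 ≤ (∑ u, ∑ a, ∑ b, g u b * g a b) ^ 3 := by
    gcongr
  calc T ^ 6 / N ^ 7 = (T ^ 2 / N) ^ 3 / N ^ 2 / N ^ 2 := by field_simp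
    _ ≤ (∑ u, ∑ a, ∑ b, g u b * g a b) ^ 3 / N ^ 2 / N ^ 2 := by gcongr
    _ ≤ _ := by gcongr

/-- Upper bound for the number of five-cycles. -/
lemma aux_upper {V : Type*} [Fintype V] [DecidableEq V] [AddCommGroup V]
    (hV : ∀ x : V, x + x = 0) {p : ℕ} (hp : p.Prime) (hodd : Odd p) (f : V → ZMod p)
    (hf : Function.Injective f) (g : V → V → ℝ)
    (hg : ∀ a b, g a b = if f (a + b) = f a + f b then 1 else 0) :
    ∑ u, ∑ a, ∑ b, (g u b * g a b) * (∑ b', g u b' * g a b') *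
        (∑ b', g u b' * g (a + b + b') b') ≤ (Fintype.card V : ℝ) ^ 4 := by
  classical
  have : Fact p.Prime := ⟨hp⟩
  have htwo : (2 : ZMod p) ≠ 0 := by
    intro h
    have h' : ((2 : ℕ) : ZMod p) = 0 := by exact_mod_cast h
    rw [ZMod.natCast_eq_zero_iff] at h'
    have := (Nat.prime_dvd_prime_iff_eq hp Nat.prime_two).1 h'
    subst this
    exact absurd hodd (by decide)
  let P : V × V × V × V × V → Prop := fun q =>
    f (q.2.1 + q.2.2.1) = f q.2.1 + f q.2.2.1 ∧
    f (q.1 + q.2.2.2.1) = f q.1 + f q.2.2.2.1 ∧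
    f (q.2.1 + q.2.2.2.1) = f q.2.1 + f q.2.2.2.1 ∧
    f (q.1 + q.2.2.2.2) = f q.1 + f q.2.2.2.2 ∧
    f (q.2.1 + q.2.2.1 + q.2.2.2.2 + q.2.2.2.2) = f (q.2.1 + q.2.2.1 + q.2.2.2.2) + f q.2.2.2.2
  have hle : ∑ u, ∑ a, ∑ b, (g u b * g a b) * (∑ b', g u b' * g a b') *
        (∑ b', g u b' * g (a + b + b') b') ≤ ∑ q : V × V × V × V × V, if P q then (1 : ℝ) else 0 := by
    simp only [Fintype.sum_prod_type]
    refine sum_le_sum fun u _ => sum_le_sum fun a _ => sum_le_sum fun b _ => ?_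
    rw [mul_assoc, sum_mul_sum, mul_sum]
    refine sum_le_sum fun b₁ _ => ?_
    rw [mul_sum]
    refine sum_le_sum fun b₂ _ => ?_
    simp only [hg, P]
    by_cases h1 : f (a + b) = f a + f b <;> by_cases h2 : f (u + b₁) = f u + f b₁ <;>
    by_cases h3 : f (a + b₁) = f a + f b₁ <;> by_cases h4 : f (u + b₂) = f u + f b₂ <;>
    by_cases h5 : f (a + b + b₂ + b₂) = f (a + b + b₂) + f b₂ <;>
    by_cases h6 : f (u + b) = f u + f b <;> simp only [h1, h2, h3, h4, h5, h6] <;> norm_num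
  refine hle.trans ?_
  rw [sum_boole]
  have hcard : #{q | P q} ≤ Fintype.card (V × V × V × V) := by
    rw [← card_univ]
    refine card_le_card_of_injOn
      (fun q => (q.2.1 + q.2.2.1 + q.2.2.2.2, q.2.2.1, q.2.1 + q.2.2.2.1, q.1 + q.2.2.2.1))
      (fun _ _ => mem_coe.2 (mem_univ _)) ?_
    have hc : ∀ x y : V, x + y + y = x := fun x y => by rw [add_assoc, hV, add_zero]
    have main : ∀ u a b b₁ b₂ : V, P (u, a, b, b₁, b₂) →
        2 * f (a + b) = f (a + b + b₂) + f b + f (a + b₁) - f (u + b₁) +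
          f ((a + b + b₂) + b + (a + b₁) + (u + b₁)) := by
      rintro u a b b₁ b₂ ⟨h1, h2, h3, h4, h5⟩
      simp only at h1 h2 h3 h4 h5
      have e : (a + b + b₂) + b + (a + b₁) + (u + b₁) = u + b₂ := by
        have : (a + b + b₂) + b + (a + b₁) + (u + b₁)
          = (a + a) + (b + b) + (b₁ + b₁) + (u + b₂) := by abel
        rw [this]; simp only [hV, zero_add]
      rw [hc] at h5
      rw [e, h4, h3, h2, two_mul]
      nth_rewrite 1 [h5]
      rw [h1]; ring
    rintro ⟨u, a, b, b₁, b₂⟩ hq ⟨u', a', b', b₁', b₂'⟩ hq' heq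
    simp only [coe_filter, mem_univ, true_and, Set.mem_ofPred_eq] at hq hq'
    have m := main _ _ _ _ _ hq
    have m' := main _ _ _ _ _ hq'
    simp only [Prod.mk.injEq] at heq
    obtain ⟨e1, e2, e3, e4⟩ := heq
    rw [e1, e2, e3, e4] at m
    rw [e2] at e1
    have e5 : f (a + b) = f (a' + b') := by
      apply mul_left_cancel₀ htwo
      rw [m', ← m, e2]
    have e6 := hf e5
    rw [e2] at e6
    have ea : a = a' := add_right_cancel e6
    subst ea e2
    have := add_left_cancel e3
    subst this
    have := add_left_cancel e1
    subst this
    have := add_right_cancel e4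
    subst this
    rfl
  have h2 : Fintype.card (V × V × V × V) = Fintype.card V ^ 4 := by
    simp only [Fintype.card_prod]; ring
  rw [h2] at hcard
  exact_mod_cast hcard

theorem stmt_2 :
    ∃ C : ℝ, 0 < C ∧
      ∀ (n p : ℕ), p.Prime → Odd p →
        ∀ f : (Fin n → ZMod 2) → ZMod p, Function.Injective f →
          (Nat.card {xy : (Fin n → ZMod 2) × (Fin n → ZMod 2) //
              f (xy.1 + xy.2) = f xy.1 + f xy.2} : ℝ) / ((2 ^ n : ℝ) * 2 ^ n)
            ≤ C * (2 : ℝ) ^ (-(n : ℝ) / 11) := by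
  refine ⟨1, one_pos, fun n p hp hodd f hf => ?_⟩
  have hV : ∀ x : Fin n → ZMod 2, x + x = 0 := fun x => by
    funext i; exact CharTwo.add_self_eq_zero _
  set T : ℝ := (Nat.card {xy : (Fin n → ZMod 2) × (Fin n → ZMod 2) //
              f (xy.1 + xy.2) = f xy.1 + f xy.2} : ℝ) with hTdef
  let g : (Fin n → ZMod 2) → (Fin n → ZMod 2) → ℝ :=
    fun a b => if f (a + b) = f a + f b then 1 else 0
  have hT : ∑ a, ∑ b, g a b = T := by
    rw [hTdef, Nat.card_eq_fintype_card, Fintype.card_subtype, ← sum_boole,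
      Fintype.sum_prod_type]
  have hlow := aux_lower hV g (fun a b => by
    by_cases h : f (a + b) = f a + f b <;> simp [g, h]) T hT
  have hup := aux_upper hV hp hodd f hf g (fun _ _ => rfl)
  have hcard : (Fintype.card (Fin n → ZMod 2) : ℝ) = 2 ^ n := by simp
  rw [hcard] at hlow hup
  have h := hlow.trans hup
  have hN1 : (1 : ℝ) ≤ 2 ^ n := one_le_pow₀ (by norm_num)
  have hT0 : 0 ≤ T := by rw [hTdef]; positivity
  have hrp : (2 : ℝ) ^ (-(n : ℝ) / 6) ≤ 1 * (2 : ℝ) ^ (-(n : ℝ) / 11) := by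
    rw [one_mul]
    apply Real.rpow_le_rpow_of_exponent_le (by norm_num)
    have : (0 : ℝ) ≤ n := Nat.cast_nonneg n
    linarith
  refine le_trans ?_ hrp
  apply le_of_pow_le_pow_left₀ (n := 6) (by norm_num) (by positivity)
  have e : ((2 : ℝ) ^ (-(n : ℝ) / 6)) ^ 6 = ((2 : ℝ) ^ n)⁻¹ := by
    rw [← Real.rpow_natCast, ← Real.rpow_mul (by norm_num), ← Real.rpow_natCast,
      ← Real.rpow_neg (by norm_num)]
    congr 1
    push_cast
    ring
  rw [e]
  generalize (2 : ℝ) ^ n = N at *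
  have hNpos : 0 < N := by linarith
  rw [div_le_iff₀ (by positivity)] at h
  rw [div_pow, div_le_iff₀ (by positivity)]
  calc T ^ 6 ≤ N ^ 4 * N ^ 7 := h
    _ = N⁻¹ * (N * N) ^ 6 := by field_simp
end

section
/- There exists an absolute constant C such that the following holds. Let G and H be finite Abelian groups of coprime order, suppose G has n invariant factors, and let f : G → H be an injection. Then the probability over uniform independent x, y ∈ G that f(x+y) = f(x)+f(y) is at most C · 17^{−n/79}. -/
open scoped Pointwise in
/-- A subset minimising the difference-growth ratio satisfies the Petridis inequality. -/
theorem exists_petridis_subset {M : Type*} [AddCommGroup M] [DecidableEq M] (A : Finset M)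
    (hA : A.Nonempty) (K : ℝ) (hK : ((A - A).card : ℝ) ≤ K * A.card) :
    ∃ X ⊆ A, X.Nonempty ∧ ∀ C : Finset M, ((C + X - A).card : ℝ) ≤ K * (C + X).card := by
  have hA' : A ∈ A.powerset.erase ∅ :=
    Finset.mem_erase_of_ne_of_mem hA.ne_empty (Finset.mem_powerset_self _)
  obtain ⟨X, hX, hmin⟩ := Finset.exists_min_image (A.powerset.erase ∅)
    (fun C ↦ ((C - A).card : ℝ) / C.card) ⟨A, hA'⟩
  rw [Finset.mem_erase, Finset.mem_powerset] at hX
  have hXne : X.Nonempty := Finset.nonempty_iff_ne_empty.2 hX.1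
  have hXpos : (0 : ℝ) < X.card := by exact_mod_cast hXne.card_pos
  have hApos : (0 : ℝ) < A.card := by exact_mod_cast hA.card_pos
  refine ⟨X, hX.2, hXne, fun C ↦ ?_⟩
  have key := Finset.pluennecke_petridis_inequality_add (A := X) (B := -A) C (by
    intro Y hY
    rcases Y.eq_empty_or_nonempty with rfl | hYne
    · simp
    have hYpos : (0 : ℝ) < Y.card := by exact_mod_cast hYne.card_pos
    have h := hmin Y (Finset.mem_erase_of_ne_of_mem hYne.ne_empty
      (Finset.mem_powerset.2 (hY.trans hX.2)))
    rw [div_le_div_iff₀ hXpos hYpos] at h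
    rw [← sub_eq_add_neg, ← sub_eq_add_neg]
    exact_mod_cast h)
  rw [← sub_eq_add_neg, ← sub_eq_add_neg] at key
  have h1 : ((X - A).card : ℝ) / X.card ≤ K :=
    (hmin A hA').trans (by rw [div_le_iff₀ hApos]; exact hK)
  rw [div_le_iff₀ hXpos] at h1
  have key' : ((C + X - A).card : ℝ) * X.card ≤ (X - A).card * (C + X).card := by
    exact_mod_cast key
  have : ((C + X - A).card : ℝ) * X.card ≤ (K * (C + X).card) * X.card := by
    refine key'.trans ?_
    calc ((X - A).card : ℝ) * (C + X).card ≤ (K * X.card) * (C + X).card := by gcongr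
      _ = _ := by ring
  exact le_of_mul_le_mul_right this hXpos

open scoped Pointwise in
/-- Bound for sums of dilates. -/
theorem card_sub_dilate_le {M : Type*} [AddCommGroup M] [DecidableEq M] (A X : Finset M)
    (hXA : X ⊆ A) (hX : X.Nonempty) (K : ℝ) (hK1 : 1 ≤ K)
    (hP : ∀ C : Finset M, ((C + X - A).card : ℝ) ≤ K * (C + X).card)
    (h2 : Set.InjOn (fun x : M ↦ (2 : ℕ) • x) X) (q : ℕ) (hq : 2 ≤ q) :
    ((X - A.image (fun a ↦ q • a)).card : ℝ) ≤ K ^ (3 * Nat.log 2 q) * X.card := by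
  have hK0 : 0 ≤ K := by linarith
  have hXpos : (0 : ℝ) < X.card := by exact_mod_cast hX.card_pos
  have e1 : ((X - A).card : ℝ) ≤ K * X.card := by
    have := hP 0
    rwa [zero_add] at this
  -- adding a copy of `-A` costs a factor `K`
  have step : ∀ D : Finset M, ((X - D - A).card : ℝ) ≤ K * (X - D).card := by
    intro D
    have := hP (-D)
    rwa [neg_add_eq_sub] at this
  have e2 : ((X - A - A).card : ℝ) ≤ K ^ 2 * X.card := by
    calc ((X - A - A).card : ℝ) ≤ K * (X - A).card := step A
      _ ≤ K * (K * X.card) := by gcongr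
      _ = _ := by ring
  have e3 : ((X - A - A - A).card : ℝ) ≤ K ^ 3 * X.card := by
    have : X - A - A - A = X - (A + A) - A := by rw [sub_sub X A A]
    rw [this]
    calc ((X - (A + A) - A).card : ℝ) ≤ K * (X - (A + A)).card := step _
      _ ≤ K * (K ^ 2 * X.card) := by rw [← sub_sub]; gcongr
      _ = _ := by ring
  induction q using Nat.strong_induction_on with
  | _ q ih =>
    rcases Nat.lt_or_ge q 4 with h4 | h4
    · have hlog : Nat.log 2 q = 1 := by
        refine Nat.log_eq_of_pow_le_of_lt_pow ?_ ?_ <;> omega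
      rw [hlog]
      have hsub : X - A.image (fun a ↦ q • a) ⊆ X - A - A ∨
          X - A.image (fun a ↦ q • a) ⊆ X - A - A - A := by
        interval_cases q
        · left
          intro z hz
          obtain ⟨x, hx, y, hy, rfl⟩ := Finset.mem_sub.1 hz
          obtain ⟨a, ha, rfl⟩ := Finset.mem_image.1 hy
          have : x - 2 • a = x - a - a := by abel
          rw [this]
          exact Finset.sub_mem_sub (Finset.sub_mem_sub hx ha) ha
        · right
          intro z hz
          obtain ⟨x, hx, y, hy, rfl⟩ := Finset.mem_sub.1 hz
          obtain ⟨a, ha, rfl⟩ := Finset.mem_image.1 hy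
          have : x - 3 • a = x - a - a - a := by abel
          rw [this]
          exact Finset.sub_mem_sub (Finset.sub_mem_sub (Finset.sub_mem_sub hx ha) ha) ha
      have h23 : K ^ 2 * (X.card : ℝ) ≤ K ^ 3 * X.card := by
        gcongr
        norm_num
      rcases hsub with h | h
      · calc _ ≤ ((X - A - A).card : ℝ) := by exact_mod_cast Finset.card_le_card h
          _ ≤ _ := e2.trans h23
      · calc _ ≤ ((X - A - A - A).card : ℝ) := by exact_mod_cast Finset.card_le_card h
          _ ≤ _ := e3
    · set r := q / 2 with hr
      have hr2 : 2 ≤ r := by omega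
      have hlog : Nat.log 2 q = Nat.log 2 r + 1 := by
        rw [Nat.log_of_one_lt_of_le (by norm_num) (by omega)]
      have ihr := ih r (by omega) hr2
      set Y := A.image (fun a ↦ r • a) with hY
      set Y2 := Y.image (fun a ↦ (2 : ℕ) • a) with hY2
      set X2 := X.image (fun a ↦ (2 : ℕ) • a) with hX2
      have hX2c : X2.card = X.card := Finset.card_image_of_injOn h2
      have tri := Finset.ruzsa_triangle_inequality_sub_sub_sub X X2 Y2
      have t1 : ((X - X2).card : ℝ) ≤ K ^ 2 * X.card := by
        refine le_trans ?_ e2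
        have : X - X2 ⊆ X - A - A := by
          intro z hz
          obtain ⟨x, hx, y, hy, rfl⟩ := Finset.mem_sub.1 hz
          obtain ⟨a, ha, rfl⟩ := Finset.mem_image.1 hy
          have : x - 2 • a = x - a - a := by abel
          rw [this]
          exact Finset.sub_mem_sub (Finset.sub_mem_sub hx (hXA ha)) (hXA ha)
        exact_mod_cast Finset.card_le_card this
      have t2 : ((Y2 - X2).card : ℝ) ≤ (X - Y).card := by
        have : Y2 - X2 ⊆ (X - Y).image (fun a ↦ -((2 : ℕ) • a)) := by
          intro z hz
          obtain ⟨x, hx, y, hy, rfl⟩ := Finset.mem_sub.1 hz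
          obtain ⟨a, ha, rfl⟩ := Finset.mem_image.1 hy
          obtain ⟨b, hb, rfl⟩ := Finset.mem_image.1 hx
          refine Finset.mem_image.2 ⟨a - b, Finset.sub_mem_sub ha hb, ?_⟩
          simp only [smul_sub, neg_sub]
        exact_mod_cast (Finset.card_le_card this).trans Finset.card_image_le
      have t3 : ((X - Y2).card : ℝ) ≤ K ^ 2 * (X - Y).card := by
        rw [hX2c] at tri
        have tri' : ((X - Y2).card : ℝ) * X.card ≤ (X - X2).card * (Y2 - X2).card := by
          exact_mod_cast tri
        have : ((X - Y2).card : ℝ) * X.card ≤ (K ^ 2 * (X - Y).card) * X.card := by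
          calc _ ≤ _ := tri'
            _ ≤ (K ^ 2 * X.card) * (X - Y).card := by gcongr
            _ = _ := by ring
        exact le_of_mul_le_mul_right this hXpos
      have t4 : ((X - Y2 - A).card : ℝ) ≤ K ^ 3 * (X - Y).card := by
        calc _ ≤ K * ((X - Y2).card : ℝ) := step _
          _ ≤ K * (K ^ 2 * (X - Y).card) := by gcongr
          _ = _ := by ring
      have t5 : ((X - A.image (fun a ↦ q • a)).card : ℝ) ≤ K ^ 3 * (X - Y).card := by
        rcases Nat.even_or_odd q with he | ho
        · have hqe : q = r * 2 := by rcases he with ⟨s, hs⟩; omega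
          have hsub : X - A.image (fun a ↦ q • a) ⊆ X - Y2 := by
            intro z hz
            obtain ⟨x, hx, y, hy, rfl⟩ := Finset.mem_sub.1 hz
            obtain ⟨a, ha, rfl⟩ := Finset.mem_image.1 hy
            refine Finset.sub_mem_sub hx ?_
            refine Finset.mem_image.2 ⟨r • a, Finset.mem_image_of_mem _ ha, ?_⟩
            change 2 • (r • a) = q • a
            rw [smul_smul, mul_comm, ← hqe]
          calc _ ≤ ((X - Y2).card : ℝ) := by exact_mod_cast Finset.card_le_card hsub
            _ ≤ _ := t3
            _ ≤ _ := mul_le_mul_of_nonneg_right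
              (pow_le_pow_right₀ hK1 (by norm_num)) (Nat.cast_nonneg _)
        · have hqe : q = 2 * r + 1 := by rcases ho with ⟨s, hs⟩; omega
          have hsub : X - A.image (fun a ↦ q • a) ⊆ X - Y2 - A := by
            intro z hz
            obtain ⟨x, hx, y, hy, rfl⟩ := Finset.mem_sub.1 hz
            obtain ⟨a, ha, rfl⟩ := Finset.mem_image.1 hy
            have : x - q • a = x - 2 • (r • a) - a := by
              rw [hqe, add_smul, mul_smul, one_smul, sub_sub]
            simp only [this]
            exact Finset.sub_mem_sub (Finset.sub_mem_sub hx
              (Finset.mem_image.2 ⟨r • a, Finset.mem_image_of_mem _ ha, rfl⟩)) ha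
          calc _ ≤ ((X - Y2 - A).card : ℝ) := by exact_mod_cast Finset.card_le_card hsub
            _ ≤ _ := t4
      calc _ ≤ _ := t5
        _ ≤ K ^ 3 * (K ^ (3 * Nat.log 2 r) * X.card) := by gcongr
        _ = _ := by rw [hlog]; ring

/-- Graph-theoretic part of the Balog-Szemeredi-Gowers argument (paths of length four). -/
theorem exists_many_paths {V : Type*} [Fintype V] [DecidableEq V] (r : V → V → Prop)
    [DecidableRel r] (δ : ℝ) (hδ : 0 < δ) (hV : 0 < Fintype.card V)
    (he : ((Finset.univ.filter fun p : V × V ↦ r p.1 p.2).card : ℝ)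
      = δ * (Fintype.card V : ℝ) ^ 2) :
    ∃ (S : Finset V) (u : ℝ), 0 < u ∧ δ ^ 2 * (Fintype.card V : ℝ) ^ 2 / 2 ≤ u ^ 2 ∧
      u / 2 ≤ S.card ∧ ∀ a ∈ S, ∀ c ∈ S,
        (u / 2) * (δ ^ 2 * Fintype.card V / 16) ^ 2 ≤
          ((Finset.univ.filter fun t : V × V × V ↦
            r a t.2.1 ∧ r t.1 t.2.1 ∧ r t.1 t.2.2 ∧ r c t.2.2).card : ℝ) := by
  set N : ℝ := (Fintype.card V : ℝ) with hN
  have hNpos : 0 < N := by rw [hN]; exact_mod_cast hV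
  set θ : ℝ := δ ^ 2 * N / 16 with hθ
  have hθpos : 0 < θ := by positivity
  let U : V → Finset V := fun b ↦ Finset.univ.filter fun a ↦ r a b
  let cd : V → V → ℝ := fun a c ↦ ((Finset.univ.filter fun b ↦ r a b ∧ r c b).card : ℝ)
  let B : V → Finset (V × V) := fun b ↦
    Finset.univ.filter fun p ↦ (r p.1 b ∧ r p.2 b) ∧ cd p.1 p.2 < θ
  have hsumU : ∑ b, ((U b).card : ℝ) = δ * N ^ 2 := by
    rw [← he]
    simp only [U, Finset.card_filter, Fintype.sum_prod_type_right]
    push_cast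
    rfl
  have hsumU2 : δ ^ 2 * N ^ 3 ≤ ∑ b, ((U b).card : ℝ) ^ 2 := by
    have := sq_sum_le_card_mul_sum_sq (s := (Finset.univ : Finset V))
      (f := fun b ↦ ((U b).card : ℝ))
    rw [hsumU, Finset.card_univ, ← hN] at this
    have h3 : N * (δ ^ 2 * N ^ 3) ≤ N * ∑ b, ((U b).card : ℝ) ^ 2 := by
      calc _ = (δ * N ^ 2) ^ 2 := by ring
        _ ≤ _ := this
    exact le_of_mul_le_mul_left h3 hNpos
  have hsumB : ∑ b, ((B b).card : ℝ) ≤ N ^ 2 * θ := by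
    have h1 : ∑ b, ((B b).card : ℝ) = ∑ p : V × V, if cd p.1 p.2 < θ then cd p.1 p.2 else 0 := by
      have : ∀ b, ((B b).card : ℝ) =
          ∑ p : V × V, if (r p.1 b ∧ r p.2 b) ∧ cd p.1 p.2 < θ then (1 : ℝ) else 0 := by
        intro b
        simp only [B, Finset.card_filter]
        push_cast
        rfl
      simp only [this]
      rw [Finset.sum_comm]
      refine Finset.sum_congr rfl fun p _ ↦ ?_
      by_cases hp : cd p.1 p.2 < θ
      · simp only [hp, and_true, if_true]
        simp only [cd, Finset.card_filter]
        push_cast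
        rfl
      · simp [hp]
    rw [h1]
    calc _ ≤ ∑ p : V × V, θ := by
          refine Finset.sum_le_sum fun p _ ↦ ?_
          split_ifs with h
          · exact h.le
          · exact hθpos.le
      _ = _ := by
          rw [Finset.sum_const, Finset.card_univ, Fintype.card_prod, nsmul_eq_mul, hN]
          push_cast
          ring
  obtain ⟨b, hb⟩ : ∃ b, δ ^ 2 * N ^ 2 / 2 ≤ ((U b).card : ℝ) ^ 2 - 8 * (B b).card := by
    by_contra hcon
    push Not at hcon
    have hne : (Finset.univ : Finset V).Nonempty := by
      rw [← Finset.card_pos, Finset.card_univ]; exact hV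
    have h1 := Finset.sum_lt_sum_of_nonempty hne (fun b _ ↦ hcon b)
    rw [Finset.sum_sub_distrib, ← Finset.mul_sum, Finset.sum_const, Finset.card_univ,
      nsmul_eq_mul, ← hN] at h1
    have : N ^ 2 * θ = δ ^ 2 * N ^ 3 / 16 := by rw [hθ]; ring
    rw [this] at hsumB
    have : N * (δ ^ 2 * N ^ 2 / 2) = δ ^ 2 * N ^ 3 / 2 := by ring
    linarith
  set W := U b with hW
  set u : ℝ := (W.card : ℝ) with hu
  have hBnn : (0 : ℝ) ≤ (B b).card := by positivity
  have hu2 : δ ^ 2 * N ^ 2 / 2 ≤ u ^ 2 := by linarith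
  have hupos : 0 < u := by
    have h0 : 0 ≤ u := by positivity
    have h1 : 0 < u ^ 2 := lt_of_lt_of_le (by positivity) hu2
    exact lt_of_le_of_ne h0 (fun h ↦ by rw [← h] at h1; norm_num at h1)
  have hB8 : 8 * ((B b).card : ℝ) ≤ u ^ 2 := by
    have : 0 < δ ^ 2 * N ^ 2 / 2 := by positivity
    linarith
  let Z : V → Finset V := fun a ↦ W.filter fun c ↦ cd a c < θ
  let S : Finset V := W.filter fun a ↦ ((Z a).card : ℝ) ≤ u / 4
  have hBZ : ((B b).card : ℝ) = ∑ a ∈ W, ((Z a).card : ℝ) := by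
    have : B b = (W ×ˢ W).filter fun p ↦ cd p.1 p.2 < θ := by
      ext p
      simp [B, W, U]
    rw [this, Finset.card_filter, Finset.sum_product]
    push_cast
    refine Finset.sum_congr rfl fun a _ ↦ ?_
    simp only [Z, Finset.card_filter]
    push_cast
    rfl
  have hS : u / 2 ≤ S.card := by
    have h1 : ((W.filter fun a ↦ ¬ ((Z a).card : ℝ) ≤ u / 4).card : ℝ) * (u / 4) ≤ (B b).card := by
      rw [hBZ]
      calc _ ≤ ∑ a ∈ W.filter (fun a ↦ ¬ ((Z a).card : ℝ) ≤ u / 4), ((Z a).card : ℝ) := by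
            rw [← nsmul_eq_mul]
            refine Finset.card_nsmul_le_sum _ _ _ fun a ha ↦ ?_
            exact (not_le.1 (Finset.mem_filter.1 ha).2).le
        _ ≤ _ := Finset.sum_le_sum_of_subset_of_nonneg (Finset.filter_subset _ _)
            (fun _ _ _ ↦ by positivity)
    have h2 : (S.card : ℝ) + ((W.filter fun a ↦ ¬ ((Z a).card : ℝ) ≤ u / 4).card : ℝ) = u := by
      rw [hu]
      exact_mod_cast Finset.card_filter_add_card_filter_not (s := W) _
    nlinarith
  refine ⟨S, u, hupos, hu2, hS, fun a ha c hc ↦ ?_⟩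
  have ha' := (Finset.mem_filter.1 ha).2
  have hc' := (Finset.mem_filter.1 hc).2
  have hcount : ((Finset.univ.filter fun t : V × V × V ↦
      r a t.2.1 ∧ r t.1 t.2.1 ∧ r t.1 t.2.2 ∧ r c t.2.2).card : ℝ) =
      ∑ x, cd a x * cd c x := by
    rw [Finset.card_filter]
    push_cast
    rw [Fintype.sum_prod_type]
    refine Finset.sum_congr rfl fun x _ ↦ ?_
    rw [Fintype.sum_prod_type]
    simp only [cd, Finset.card_filter]
    push_cast
    rw [Finset.sum_mul_sum]
    refine Finset.sum_congr rfl fun y _ ↦ Finset.sum_congr rfl fun z _ ↦ ?_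
    by_cases h1 : r a y <;> by_cases h2 : r x y <;> by_cases h3 : r x z <;>
      by_cases h4 : r c z <;> simp [h1, h2, h3, h4]
  rw [hcount]
  let Q : Finset V := W \ (Z a ∪ Z c)
  have hQ : u / 2 ≤ Q.card := by
    have h1 : (W.card : ℝ) ≤ Q.card + (Z a ∪ Z c).card := by
      exact_mod_cast (Nat.sub_le_iff_le_add.1 (Finset.le_card_sdiff (Z a ∪ Z c) W))
    have h2 : ((Z a ∪ Z c).card : ℝ) ≤ (Z a).card + (Z c).card := by
      exact_mod_cast Finset.card_union_le _ _
    rw [← hu] at h1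
    linarith
  calc u / 2 * θ ^ 2 ≤ Q.card * θ ^ 2 := by gcongr
    _ ≤ ∑ x ∈ Q, cd a x * cd c x := by
        rw [← nsmul_eq_mul]
        refine Finset.card_nsmul_le_sum _ _ _ fun x hx ↦ ?_
        simp only [Q, Z, Finset.mem_sdiff, Finset.mem_union, Finset.mem_filter, not_or,
          not_and, not_lt] at hx
        have h1 := hx.2.1 hx.1
        have h2 := hx.2.2 hx.1
        rw [sq]
        exact mul_le_mul h1 h2 hθpos.le (hθpos.le.trans h1)
    _ ≤ _ := Finset.sum_le_sum_of_subset_of_nonneg (Finset.subset_univ _)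
        (fun _ _ _ ↦ by positivity)

theorem smul_inj_of_coprime {G : Type*} [AddCommGroup G] [Finite G] (m : ℕ)
    (h : (Nat.card G).Coprime m) : Function.Injective (fun x : G ↦ m • x) :=
  (nsmulCoprime h).injective

open scoped Pointwise in
theorem core_bound {G H : Type*} [AddCommGroup G] [AddCommGroup H] [Fintype G] [Fintype H]
    [DecidableEq G] [DecidableEq H]
    (hco : (Nat.card G).Coprime (Nat.card H)) (f : G → H) (hf : Function.Injective f)
    (p : ℕ) (hp : p.Prime) (hpH : (Nat.card H).Coprime p) (ker : Finset G)
    (hker : ∀ g : G, p • g ∈ ker) (n : ℕ) (hkc : ker.card * p ^ n = Fintype.card G)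
    (δ : ℝ) (hδ : 0 < δ) (hδ1 : δ ≤ 1)
    (he : ((Finset.univ.filter fun q : G × G ↦ f (q.1 + q.2) = f q.1 + f q.2).card : ℝ)
      = δ * (Fintype.card G : ℝ) ^ 2) :
    δ / 4 * (p : ℝ) ^ n ≤ (2048 / δ ^ 6) ^ (3 * Nat.log 2 p) := by
  have hV : 0 < Fintype.card G := Fintype.card_pos
  obtain ⟨S, u, hu, hu2, hS, hpaths⟩ :=
    exists_many_paths (fun x y : G ↦ f (x + y) = f x + f y) δ hδ hV he
  set N : ℝ := (Fintype.card G : ℝ) with hN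
  have hNpos : 0 < N := by rw [hN]; exact_mod_cast hV
  let ι : G → G × H := fun x ↦ (x, f x)
  have hι : Function.Injective ι := fun x y h ↦ congrArg Prod.fst h
  let A : Finset (G × H) := S.image ι
  have hAc : A.card = S.card := Finset.card_image_of_injective _ hι
  have hSpos : (0 : ℝ) < S.card := lt_of_lt_of_le (by positivity) hS
  have hA : A.Nonempty := by
    rw [← Finset.card_pos, hAc]; exact_mod_cast hSpos
  -- the difference set is small
  let g : G × G × G × G → G × H := fun t ↦ ι t.1 - ι t.2.1 + ι t.2.2.1 - ι t.2.2.2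
  set m : ℝ := u / 2 * (δ ^ 2 * N / 16) ^ 2 with hm
  have hmpos : 0 < m := by positivity
  have hfib : ∀ d ∈ A - A, m ≤ ((Finset.univ.filter fun t ↦ g t = d).card : ℝ) := by
    intro d hd
    obtain ⟨x, hx, y, hy, rfl⟩ := Finset.mem_sub.1 hd
    obtain ⟨a, ha, rfl⟩ := Finset.mem_image.1 hx
    obtain ⟨c, hc, rfl⟩ := Finset.mem_image.1 hy
    refine (hpaths a ha c hc).trans ?_
    have : (Finset.univ.filter fun t : G × G × G ↦
        f (a + t.2.1) = f a + f t.2.1 ∧ f (t.1 + t.2.1) = f t.1 + f t.2.1 ∧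
        f (t.1 + t.2.2) = f t.1 + f t.2.2 ∧ f (c + t.2.2) = f c + f t.2.2).card ≤
        (Finset.univ.filter fun t ↦ g t = ι a - ι c).card := by
      refine Finset.card_le_card_of_injOn
        (fun t ↦ (a + t.2.1, t.1 + t.2.1, t.1 + t.2.2, c + t.2.2)) ?_ ?_
      · rintro ⟨t, b, b'⟩ ht
        simp only [Finset.coe_filter, Finset.mem_univ, true_and, Set.mem_ofPred_eq] at ht ⊢
        obtain ⟨h1, h2, h3, h4⟩ := ht
        simp only [g, ι, h1, h2, h3, h4, Prod.mk_sub_mk, Prod.mk_add_mk, Prod.mk.injEq]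
        constructor <;> abel
      · rintro ⟨t, b, b'⟩ _ ⟨s, e, e'⟩ _ h
        simp only [Prod.mk.injEq, add_right_inj] at h
        obtain ⟨h1, h2, h3, h4⟩ := h
        subst h1 h4
        simp only [add_left_inj] at h2
        subst h2
        rfl
    exact_mod_cast this
  have hdiff : ((A - A).card : ℝ) * m ≤ N ^ 4 := by
    calc ((A - A).card : ℝ) * m ≤
          ∑ d ∈ A - A, ((Finset.univ.filter fun t ↦ g t = d).card : ℝ) := by
          rw [← nsmul_eq_mul]
          exact Finset.card_nsmul_le_sum _ _ _ hfib
      _ ≤ ∑ d, ((Finset.univ.filter fun t ↦ g t = d).card : ℝ) :=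
          Finset.sum_le_sum_of_subset_of_nonneg (Finset.subset_univ _) (fun _ _ _ ↦ by positivity)
      _ = ((Finset.univ : Finset (G × G × G × G)).card : ℝ) := by
          rw [Finset.card_eq_sum_card_fiberwise (f := g) (t := Finset.univ) (by simp)]
          push_cast
          rfl
      _ = N ^ 4 := by
          rw [Finset.card_univ, Fintype.card_prod, Fintype.card_prod, Fintype.card_prod]
          push_cast
          rw [← hN]
          ring
  set K : ℝ := 2048 / δ ^ 6 with hKdef
  have hK1 : 1 ≤ K := by
    rw [hKdef, le_div_iff₀ (by positivity)]
    have : δ ^ 6 ≤ 1 := pow_le_one₀ hδ.le hδ1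
    linarith
  have hK : ((A - A).card : ℝ) ≤ K * A.card := by
    have h1 : N ^ 4 ≤ (K * A.card) * m := by
      have h2 : N ^ 4 ≤ K * (u / 2) * m := by
        have h3 : K * (u / 2) * m = 2 * N ^ 2 * u ^ 2 / δ ^ 2 := by
          rw [hKdef, hm]
          field_simp
          ring
        rw [h3, le_div_iff₀ (by positivity)]
        have := mul_le_mul_of_nonneg_left hu2 (by positivity : 0 ≤ 2 * N ^ 2)
        linarith [this]
      refine h2.trans ?_
      rw [hAc]
      gcongr
    exact le_of_mul_le_mul_right (hdiff.trans h1) hmpos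
  obtain ⟨X, hXA, hX, hP⟩ := exists_petridis_subset A hA K hK
  have hXpos : (0 : ℝ) < X.card := by exact_mod_cast hX.card_pos
  have hgraph : ∀ x ∈ A, x.2 = f x.1 := by
    intro x hx
    obtain ⟨a, _, rfl⟩ := Finset.mem_image.1 hx
    rfl
  have hfst : ∀ x ∈ A, ∀ y ∈ A, x.1 = y.1 → x = y := by
    intro x hx y hy h
    exact Prod.ext h (by rw [hgraph x hx, hgraph y hy, h])
  have hsnd : ∀ x ∈ A, ∀ y ∈ A, x.2 = y.2 → x = y := by
    intro x hx y hy h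
    refine hfst x hx y hy (hf ?_)
    rw [← hgraph x hx, ← hgraph y hy, h]
  have h2 : Set.InjOn (fun x : G × H ↦ (2 : ℕ) • x) X := by
    intro x hx y hy h
    have hx' := hXA hx
    have hy' := hXA hy
    by_cases hev : (Nat.card G).Coprime 2
    · exact hfst x hx' y hy' (smul_inj_of_coprime 2 hev (congrArg Prod.fst h))
    · have h2G : 2 ∣ Nat.card G := by
        rw [Nat.coprime_comm, Nat.Prime.coprime_iff_not_dvd Nat.prime_two, not_not] at hev
        exact hev
      have : (Nat.card H).Coprime 2 := (hco.coprime_dvd_left h2G).symm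
      exact hsnd x hx' y hy' (smul_inj_of_coprime 2 this (congrArg Prod.snd h))
  have hdil := card_sub_dilate_le A X hXA hX K hK1 hP h2 p hp.two_le
  set D : Finset (G × H) := A.image (fun a ↦ p • a) with hD
  have hDc : D.card = A.card := by
    refine Finset.card_image_of_injOn ?_
    intro x hx y hy h
    exact hsnd x hx y hy (smul_inj_of_coprime p hpH (congrArg Prod.snd h))
  have hDle : D.card ≤ ((X - D).card / X.card) * ker.card := by
    refine Finset.card_le_mul_card_image_of_maps_to (f := fun d ↦ d.1) (t := ker) ?_ _ ?_
    · intro d hd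
      obtain ⟨a, _, rfl⟩ := Finset.mem_image.1 hd
      exact hker a.1
    · intro z _
      rw [Nat.le_div_iff_mul_le hX.card_pos, ← Finset.card_product]
      refine Finset.card_le_card_of_injOn (fun t ↦ t.2 - t.1) ?_ ?_
      · rintro ⟨d, x⟩ ht
        simp only [Finset.coe_product, Set.mem_prod, Finset.mem_coe, Finset.mem_filter] at ht
        exact Finset.sub_mem_sub ht.2 ht.1.1
      · rintro ⟨d, x⟩ ht ⟨e, y⟩ hs h
        simp only [Finset.coe_product, Set.mem_prod, Finset.mem_coe, Finset.mem_filter] at ht hs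
        simp only at h
        have hxy : x = y := by
          refine hfst x (hXA ht.2) y (hXA hs.2) ?_
          have h1 := congrArg Prod.fst h
          simp only [Prod.fst_sub, ht.1.2, hs.1.2] at h1
          exact sub_left_injective h1
        subst hxy
        rw [sub_right_injective h]
  have hfin : (A.card : ℝ) * X.card * (p : ℝ) ^ n ≤ (X - D).card * N := by
    have h1 : A.card * X.card * p ^ n ≤ (X - D).card * Fintype.card G := by
      rw [← hkc, ← hDc]
      calc D.card * X.card * p ^ n
          ≤ ((X - D).card / X.card * ker.card) * X.card * p ^ n := by gcongr
        _ = ((X - D).card / X.card * X.card) * (ker.card * p ^ n) := by ring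
        _ ≤ _ := by gcongr; exact Nat.div_mul_le_self _ _
    rw [hN]
    exact_mod_cast h1
  have huN : δ * N / 2 ≤ u := by
    refine (sq_le_sq₀ (by positivity) hu.le).1 ?_
    have : 0 ≤ δ ^ 2 * N ^ 2 := by positivity
    nlinarith
  have hAge : δ / 4 * N ≤ A.card := by
    rw [hAc]; linarith
  have hpn : (0 : ℝ) ≤ (p : ℝ) ^ n := by positivity
  have : (δ / 4 * (p : ℝ) ^ n) * (N * X.card) ≤ K ^ (3 * Nat.log 2 p) * (N * X.card) := by
    calc _ = (δ / 4 * N) * X.card * (p : ℝ) ^ n := by ring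
      _ ≤ A.card * X.card * (p : ℝ) ^ n := by gcongr
      _ ≤ (X - D).card * N := hfin
      _ ≤ (K ^ (3 * Nat.log 2 p) * X.card) * N := by gcongr
      _ = _ := by ring
  exact le_of_mul_le_mul_right this (by positivity)

/-- Kernel of reduction modulo `p`. -/
theorem exists_ker {G : Type*} [AddCommGroup G] [Fintype G] (n : ℕ) (d : Fin n → ℕ) (p : ℕ)
    (hp : p.Prime) (hd : ∀ i, p ∣ d i) (e : G ≃+ ((i : Fin n) → ZMod (d i))) :
    ∃ ker : Finset G, (∀ g : G, p • g ∈ ker) ∧ ker.card * p ^ n = Fintype.card G := by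
  classical
  have : NeZero p := ⟨hp.ne_zero⟩
  let ψ : ((i : Fin n) → ZMod (d i)) →+ (Fin n → ZMod p) :=
    { toFun := fun x i ↦ ZMod.castHom (hd i) (ZMod p) (x i)
      map_zero' := by ext i; simp
      map_add' := by intro x y; ext i; exact map_add (ZMod.castHom (hd i) (ZMod p)) (x i) (y i) }
  have hψ : Function.Surjective ψ := by
    intro y
    choose x hx using fun i ↦ ZMod.castHom_surjective (hd i) (y i)
    exact ⟨x, funext hx⟩
  let φ : G →+ (Fin n → ZMod p) := ψ.comp e.toAddMonoidHom
  have hφ : Function.Surjective φ := hψ.comp e.surjective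
  refine ⟨Finset.univ.filter fun g ↦ φ g = 0, fun g ↦ ?_, ?_⟩
  · simp only [Finset.mem_filter, Finset.mem_univ, true_and, map_nsmul]
    ext i
    simp
  · have h1 := φ.ker.card_mul_index
    rw [AddSubgroup.index_ker, AddMonoidHom.range_eq_top.2 hφ] at h1
    have h2 : Nat.card (⊤ : AddSubgroup (Fin n → ZMod p)) = p ^ n := by
      rw [AddSubgroup.card_top]
      simp
    rw [h2, Nat.card_eq_fintype_card (α := G)] at h1
    rw [← h1]
    congr 1
    rw [← Fintype.card_subtype, ← Nat.card_eq_fintype_card]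
    rfl

theorem final_numeric (δ : ℝ) (hδ : 0 < δ) (hδ1 : δ ≤ 1) (n p : ℕ) (hp : 2 ≤ p)
    (h : δ / 4 * (p : ℝ) ^ n ≤ (2048 / δ ^ 6) ^ (3 * Nat.log 2 p)) :
    δ ≤ 4 * (17 : ℝ) ^ (-(n : ℝ) / 79) := by
  set k := Nat.log 2 p with hk
  have hk1 : 1 ≤ k := Nat.log_pos (by norm_num) hp
  have hpk : (2 : ℝ) ^ k ≤ p := by
    exact_mod_cast Nat.pow_log_le_self 2 (by omega)
  have h1 : δ / 4 * ((2 : ℝ) ^ k) ^ n ≤ (2048 / δ ^ 6) ^ (3 * k) := by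
    refine le_trans ?_ h
    gcongr
  rw [div_pow, le_div_iff₀ (by positivity)] at h1
  have h2 : δ ^ (19 * k) * 2 ^ (n * k) ≤ (2 : ℝ) ^ (35 * k) := by
    calc δ ^ (19 * k) * 2 ^ (n * k) ≤ δ ^ (18 * k + 1) * 2 ^ (n * k) := by
          gcongr ?_ * _
          exact pow_le_pow_of_le_one hδ.le hδ1 (by omega)
      _ = 4 * (δ / 4 * ((2 : ℝ) ^ k) ^ n * (δ ^ 6) ^ (3 * k)) := by
          rw [← pow_mul, ← pow_mul, pow_succ, mul_comm k n,
            show 6 * (3 * k) = 18 * k by ring]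
          ring
      _ ≤ 4 * 2048 ^ (3 * k) := by gcongr
      _ = 2 ^ (33 * k + 2) := by
          rw [show (2048 : ℝ) = 2 ^ 11 by norm_num, ← pow_mul, pow_add,
            show 11 * (3 * k) = 33 * k by ring]
          ring
      _ ≤ _ := pow_le_pow_right₀ (by norm_num) (by omega)
  have h3 : δ ^ 19 * 2 ^ n ≤ (2 : ℝ) ^ 35 := by
    rw [pow_mul, pow_mul, pow_mul, ← mul_pow] at h2
    exact le_of_pow_le_pow_left₀ (by omega) (by positivity) h2
  set t : ℝ := (17 : ℝ) ^ ((n : ℝ) / 79) with ht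
  have htpos : 0 < t := by positivity
  have ht79 : t ^ 79 = 17 ^ n := by
    rw [ht, ← Real.rpow_natCast, ← Real.rpow_mul (by norm_num)]
    rw [show (n : ℝ) / 79 * ((79 : ℕ) : ℝ) = n by push_cast; field_simp, Real.rpow_natCast]
  have ht19 : t ^ 19 ≤ 2 ^ n := by
    refine le_of_pow_le_pow_left₀ (n := 79) (by norm_num) (by positivity) ?_
    rw [← pow_mul, mul_comm, pow_mul, ht79, ← pow_mul, ← pow_mul, mul_comm n, mul_comm n,
      pow_mul, pow_mul]
    gcongr
    norm_num
  have h4 : δ * t ≤ 4 := by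
    refine le_of_pow_le_pow_left₀ (n := 19) (by norm_num) (by norm_num) ?_
    calc (δ * t) ^ 19 = δ ^ 19 * t ^ 19 := by ring
      _ ≤ δ ^ 19 * 2 ^ n := by gcongr
      _ ≤ 2 ^ 35 := h3
      _ ≤ 4 ^ 19 := by norm_num
  rw [neg_div, Real.rpow_neg (by norm_num), ← ht, ← div_eq_mul_inv, le_div_iff₀ htpos]
  exact h4

theorem stmt_3 :
    ∃ C : ℝ, 0 < C ∧
      ∀ (G H : Type) [AddCommGroup G] [AddCommGroup H] [Fintype G] [Fintype H]
        (n : ℕ) (d : Fin n → ℕ),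
        (∀ i, 1 < d i) → (∀ i j : Fin n, i ≤ j → d i ∣ d j) →
        (Nonempty (G ≃+ ((i : Fin n) → ZMod (d i)))) →
        (Nat.card G).Coprime (Nat.card H) →
        ∀ f : G → H, Function.Injective f →
          (Nat.card {xy : G × G // f (xy.1 + xy.2) = f xy.1 + f xy.2} : ℝ) / (Nat.card G : ℝ) ^ 2
            ≤ C * (17 : ℝ) ^ (-(n : ℝ) / 79) := by
  classical
  refine ⟨4, by norm_num, ?_⟩
  intro G H _ _ _ _ n d hd1 hdd hiso hco f hf
  obtain ⟨e⟩ := hiso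
  set δ : ℝ := (Nat.card {xy : G × G // f (xy.1 + xy.2) = f xy.1 + f xy.2} : ℝ) /
    (Nat.card G : ℝ) ^ 2 with hδdef
  have hNpos : (0 : ℝ) < Nat.card G := by exact_mod_cast Nat.card_pos
  have hcard : Nat.card {xy : G × G // f (xy.1 + xy.2) = f xy.1 + f xy.2} =
      (Finset.univ.filter fun q : G × G ↦ f (q.1 + q.2) = f q.1 + f q.2).card := by
    rw [← Fintype.card_subtype, Nat.card_eq_fintype_card]
  have he : ((Finset.univ.filter fun q : G × G ↦ f (q.1 + q.2) = f q.1 + f q.2).card : ℝ)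
      = δ * (Fintype.card G : ℝ) ^ 2 := by
    rw [← hcard, ← Nat.card_eq_fintype_card, hδdef]
    field_simp
  have hδ0 : 0 ≤ δ := by positivity
  have hδ1 : δ ≤ 1 := by
    rw [hδdef, div_le_one (by positivity), hcard]
    have h1 := Finset.card_filter_le (Finset.univ : Finset (G × G))
      (fun q ↦ f (q.1 + q.2) = f q.1 + f q.2)
    rw [Finset.card_univ, Fintype.card_prod, ← sq, ← Nat.card_eq_fintype_card] at h1
    exact_mod_cast h1
  rcases hδ0.eq_or_lt with h0 | hδ
  · rw [← h0]; positivity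
  rcases Nat.eq_zero_or_pos n with rfl | hn
  · simp
    linarith
  let i0 : Fin n := ⟨0, hn⟩
  have hp : (d i0).minFac.Prime := Nat.minFac_prime (hd1 i0).ne'
  have hpd : ∀ i, (d i0).minFac ∣ d i := fun i ↦
    (Nat.minFac_dvd _).trans (hdd i0 i (Nat.zero_le _))
  obtain ⟨ker, hker, hkc⟩ := exists_ker n d _ hp hpd e
  have hpG : (d i0).minFac ∣ Nat.card G := by
    rw [Nat.card_eq_fintype_card, ← hkc]
    exact Dvd.dvd.mul_left (dvd_pow_self _ hn.ne') _
  have hpH : (Nat.card H).Coprime (d i0).minFac := (hco.coprime_dvd_left hpG).symm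
  exact final_numeric δ hδ hδ1 n _ hp.two_le
    (core_bound hco f hf _ hp hpH ker hker n hkc δ hδ hδ1 he)
end

section
/- There exists an absolute constant C such that the following holds. Let G and H be Abelian groups with G finite, let r ∈ N, and let f : G → H be an injection. Then for any α ≤ max{1/(5r+1), 1/(18⌊log₂ r⌋ + 7)}, the probability over uniform independent x,y ∈ G that f(x+y) = f(x)+f(y) is at most (C · min{|r·G||K_{H,r}|, |r·H||K_{G,r}|} / |G|)^α. -/
namespace Apx
open Classical in
noncomputable def pr {Ω : Type} [Fintype Ω] (μ : Ω → ℝ) {T : Type} (φ : Ω → T) (ω : Ω) : ℝ :=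
  ∑ ω', if φ ω' = φ ω then μ ω' else 0

noncomputable def ent {Ω : Type} [Fintype Ω] (μ : Ω → ℝ) {T : Type} (φ : Ω → T) : ℝ :=
  ∑ ω, μ ω * (-Real.log (pr μ φ ω))

/-- `φ` determines `ζ` on the support of `μ`. -/
def Det {Ω : Type} (μ : Ω → ℝ) {T S : Type} (φ : Ω → T) (ζ : Ω → S) : Prop :=
  ∀ ω ω', μ ω ≠ 0 → μ ω' ≠ 0 → φ ω = φ ω' → ζ ω = ζ ω'

section
variable {Ω : Type} [Fintype Ω] {μ : Ω → ℝ} {T S R Q : Type}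

lemma pr_nonneg (h0 : ∀ ω, 0 ≤ μ ω) (φ : Ω → T) (ω : Ω) : 0 ≤ pr μ φ ω := by
  unfold pr
  apply Finset.sum_nonneg
  intro i _
  split_ifs
  · exact h0 i
  · exact le_rfl

lemma pr_pos (h0 : ∀ ω, 0 ≤ μ ω) (φ : Ω → T) (ω : Ω) (h : μ ω ≠ 0) : 0 < pr μ φ ω := by
  classical
  have h1 : 0 < μ ω := lt_of_le_of_ne (h0 ω) (Ne.symm h)
  refine lt_of_lt_of_le h1 ?_
  unfold pr
  have := Finset.single_le_sum (f := fun ω' => if φ ω' = φ ω then μ ω' else 0) (s := Finset.univ)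
    (fun i _ => by
      split_ifs
      · exact h0 i
      · exact le_rfl) (Finset.mem_univ ω)
  simpa using this

lemma pr_congr {φ : Ω → T} {ω ω' : Ω} (h : φ ω = φ ω') : pr μ φ ω = pr μ φ ω' := by
  unfold pr; rw [h]

lemma sum_div_pr_le (h0 : ∀ ω, 0 ≤ μ ω) (χ : Ω → T) (P : Ω → Prop) [DecidablePred P]
    (hP : ∀ ω ω', P ω → P ω' → μ ω ≠ 0 → μ ω' ≠ 0 → χ ω = χ ω') :
    ∑ ω, (if P ω then μ ω / pr μ χ ω else 0) ≤ 1 := by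
  classical
  by_cases hex : ∃ ω0, P ω0 ∧ μ ω0 ≠ 0
  · obtain ⟨ω0, hp0, hm0⟩ := hex
    have hpos := pr_pos h0 χ ω0 hm0
    calc ∑ ω, (if P ω then μ ω / pr μ χ ω else 0)
        ≤ ∑ ω, (if χ ω = χ ω0 then μ ω else 0) / pr μ χ ω0 := by
          apply Finset.sum_le_sum
          intro ω _
          by_cases hm : μ ω = 0
          · simp [hm]
          · by_cases hp : P ω
            · have := hP ω ω0 hp hp0 hm hm0
              simp [hp, this, pr_congr this]
            · simp only [hp, if_false]
              apply div_nonneg _ hpos.le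
              split_ifs
              · exact h0 ω
              · exact le_rfl
      _ = 1 := by
          rw [← Finset.sum_div]
          exact div_self hpos.ne'
  · push Not at hex
    have : ∑ ω, (if P ω then μ ω / pr μ χ ω else 0) = 0 := by
      apply Finset.sum_eq_zero
      intro ω _
      split_ifs with h
      · simp [hex ω h]
      · rfl
    linarith

lemma submod (h0 : ∀ ω, 0 ≤ μ ω) (h1 : ∑ ω, μ ω = 1)
    (φ : Ω → T) (ψ : Ω → S) (ζ : Ω → R) (χ : Ω → Q)
    (hφ : Det μ φ ζ) (hψ : Det μ ψ ζ) (hχ : Det μ (fun ω => (φ ω, ψ ω)) χ) :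
    ent μ χ + ent μ ζ ≤ ent μ φ + ent μ ψ := by
  classical
  have key : ∑ ω, μ ω * (pr μ φ ω * pr μ ψ ω / (pr μ ζ ω * pr μ χ ω)) ≤ 1 := by
    have e1 : ∀ ω, μ ω * (pr μ φ ω * pr μ ψ ω / (pr μ ζ ω * pr μ χ ω)) =
        ∑ ω1, ∑ ω2, μ ω1 * μ ω2 * (if φ ω1 = φ ω ∧ ψ ω2 = ψ ω then
          (μ ω / pr μ χ ω) / pr μ ζ ω else 0) := by
      intro ω
      have : μ ω * (pr μ φ ω * pr μ ψ ω / (pr μ ζ ω * pr μ χ ω)) =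
        pr μ φ ω * (pr μ ψ ω * ((μ ω / pr μ χ ω) / pr μ ζ ω)) := by
        rw [div_div, mul_comm (pr μ χ ω)]; ring
      rw [this]
      conv_lhs => rw [pr, Finset.sum_mul]
      apply Finset.sum_congr rfl
      intro ω1 _
      conv_lhs => rw [pr, Finset.sum_mul, Finset.mul_sum]
      apply Finset.sum_congr rfl
      intro ω2 _
      by_cases ha : φ ω1 = φ ω <;> by_cases hb : ψ ω2 = ψ ω <;> simp [ha, hb]
      ring
    rw [Finset.sum_congr rfl (fun ω _ => e1 ω), Finset.sum_comm]
    have e2 : ∀ ω1, ∑ ω, ∑ ω2, μ ω1 * μ ω2 * (if φ ω1 = φ ω ∧ ψ ω2 = ψ ω then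
          (μ ω / pr μ χ ω) / pr μ ζ ω else 0) ≤ μ ω1 := by
      intro ω1
      by_cases hm1 : μ ω1 = 0
      · simp [hm1]
      rw [Finset.sum_comm]
      have hz := pr_pos h0 ζ ω1 hm1
      calc _ ≤ ∑ ω2, μ ω1 * (if ζ ω2 = ζ ω1 then μ ω2 else 0) / pr μ ζ ω1 := by
            apply Finset.sum_le_sum
            intro ω2 _
            by_cases hm2 : μ ω2 = 0
            · simp [hm2]
            have hterm : ∀ ω, μ ω1 * μ ω2 * (if φ ω1 = φ ω ∧ ψ ω2 = ψ ω then
                (μ ω / pr μ χ ω) / pr μ ζ ω else 0) ≤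
                (μ ω1 * (if ζ ω2 = ζ ω1 then μ ω2 else 0) / pr μ ζ ω1) *
                (if φ ω1 = φ ω ∧ ψ ω2 = ψ ω then μ ω / pr μ χ ω else 0) := by
              intro ω
              by_cases hm : μ ω = 0
              · simp [hm]
              by_cases hc : φ ω1 = φ ω ∧ ψ ω2 = ψ ω
              · have z1 := hφ ω1 ω hm1 hm hc.1
                have z2 := hψ ω2 ω hm2 hm hc.2
                rw [if_pos hc, if_pos hc, if_pos (z2.trans z1.symm), pr_congr z1]
                apply le_of_eq
                ring
              · simp [hc]
            refine (Finset.sum_le_sum fun ω _ => hterm ω).trans ?_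
            rw [← Finset.mul_sum]
            have hle := sum_div_pr_le h0 χ (fun ω => φ ω1 = φ ω ∧ ψ ω2 = ψ ω)
              (fun ω ω' hp hp' hm hm' => hχ ω ω' hm hm'
                (Prod.ext (hp.1.symm.trans hp'.1) (hp.2.symm.trans hp'.2)))
            apply mul_le_of_le_one_right _ hle
            apply div_nonneg _ hz.le
            apply mul_nonneg (h0 _)
            split_ifs
            · exact h0 _
            · exact le_rfl
        _ = μ ω1 := by
            rw [← Finset.sum_div, ← Finset.mul_sum]
            exact mul_div_cancel_right₀ _ hz.ne'
    calc _ ≤ ∑ ω1, μ ω1 := Finset.sum_le_sum fun ω1 _ => e2 ω1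
      _ = 1 := h1
  have hpt : ∀ ω, μ ω * (-Real.log (pr μ χ ω)) + μ ω * (-Real.log (pr μ ζ ω)) ≤
      μ ω * (-Real.log (pr μ φ ω)) + μ ω * (-Real.log (pr μ ψ ω)) +
      (μ ω * (pr μ φ ω * pr μ ψ ω / (pr μ ζ ω * pr μ χ ω)) - μ ω) := by
    intro ω
    by_cases hm : μ ω = 0
    · simp [hm]
    have p1 := pr_pos h0 φ ω hm
    have p2 := pr_pos h0 ψ ω hm
    have p3 := pr_pos h0 ζ ω hm
    have p4 := pr_pos h0 χ ω hm
    have hl := Real.log_le_sub_one_of_pos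
      (show 0 < pr μ φ ω * pr μ ψ ω / (pr μ ζ ω * pr μ χ ω) by positivity)
    rw [Real.log_div (by positivity) (by positivity), Real.log_mul p1.ne' p2.ne',
      Real.log_mul p3.ne' p4.ne'] at hl
    have := mul_le_mul_of_nonneg_left hl (h0 ω)
    linarith
  have hs := Finset.sum_le_sum (s := Finset.univ) fun ω _ => hpt ω
  simp only [Finset.sum_add_distrib, Finset.sum_sub_distrib] at hs
  unfold ent
  linarith

lemma ent_const (h1 : ∑ ω, μ ω = 1) : ent μ (fun _ => ()) = 0 := by
  simp [ent, pr, h1]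

lemma subadd (h0 : ∀ ω, 0 ≤ μ ω) (h1 : ∑ ω, μ ω = 1)
    (φ : Ω → T) (ψ : Ω → S) (χ : Ω → Q)
    (hχ : Det μ (fun ω => (φ ω, ψ ω)) χ) :
    ent μ χ ≤ ent μ φ + ent μ ψ := by
  have := submod h0 h1 φ ψ (fun _ => ()) χ (fun _ _ _ _ _ => rfl) (fun _ _ _ _ _ => rfl) hχ
  rw [ent_const h1] at this
  linarith

lemma ent_mono (h0 : ∀ ω, 0 ≤ μ ω) (h1 : ∑ ω, μ ω = 1)
    (φ : Ω → T) (χ : Ω → Q) (hχ : Det μ φ χ) : ent μ χ ≤ ent μ φ := by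
  have := subadd h0 h1 φ (fun _ => ()) χ (fun ω ω' a b h => hχ ω ω' a b (congrArg Prod.fst h))
  rw [ent_const h1] at this
  linarith

lemma ent_le_log_card [Fintype T] [Nonempty T] (h0 : ∀ ω, 0 ≤ μ ω) (h1 : ∑ ω, μ ω = 1)
    (φ : Ω → T) : ent μ φ ≤ Real.log (Fintype.card T) := by
  classical
  set k : ℝ := (Fintype.card T : ℝ) with hk
  have hkpos : 0 < k := by rw [hk]; exact_mod_cast Fintype.card_pos
  have hs : ∑ ω, μ ω / pr μ φ ω ≤ k := by
    have : ∑ ω, μ ω / pr μ φ ω = ∑ t : T, ∑ ω, (if φ ω = t then μ ω / pr μ φ ω else 0) := by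
      rw [Finset.sum_comm]
      simp
    rw [this]
    calc _ ≤ ∑ t : T, (1 : ℝ) := Finset.sum_le_sum fun t _ =>
            sum_div_pr_le h0 φ (fun ω => φ ω = t) (fun ω ω' hp hp' _ _ => hp.trans hp'.symm)
      _ = k := by simp [hk]
  have hpt : ∀ ω, μ ω * (-Real.log (pr μ φ ω)) ≤
      (μ ω / pr μ φ ω) / k - μ ω + μ ω * Real.log k := by
    intro ω
    by_cases hm : μ ω = 0
    · simp [hm]
    have p1 := pr_pos h0 φ ω hm
    have hl := Real.log_le_sub_one_of_pos (show 0 < 1 / (pr μ φ ω * k) by positivity)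
    rw [Real.log_div one_ne_zero (by positivity), Real.log_mul p1.ne' hkpos.ne', Real.log_one] at hl
    have := mul_le_mul_of_nonneg_left hl (h0 ω)
    have e : (μ ω / pr μ φ ω) / k = μ ω * (1 / (pr μ φ ω * k)) := by
      field_simp
    rw [e]
    linarith
  have hs' := Finset.sum_le_sum (s := Finset.univ) fun ω _ => hpt ω
  simp only [Finset.sum_add_distrib, Finset.sum_sub_distrib, ← Finset.sum_div, ← Finset.sum_mul,
    h1] at hs'
  have : (∑ ω, μ ω / pr μ φ ω) / k ≤ 1 := (div_le_one hkpos).2 hs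
  unfold ent
  linarith

lemma ent_comp (e : Ω ≃ Ω) (he : ∀ ω, μ (e ω) = μ ω) (φ : Ω → T) :
    ent μ (fun ω => φ (e ω)) = ent μ φ := by
  classical
  have hp : ∀ ω, pr μ (fun ω => φ (e ω)) ω = pr μ φ (e ω) := by
    intro ω
    unfold pr
    rw [← Equiv.sum_comp e (fun ω' => if φ ω' = φ (e ω) then μ ω' else 0)]
    simp [he]
  unfold ent
  rw [← Equiv.sum_comp e (fun ω => μ ω * (-Real.log (pr μ φ ω)))]
  simp [he, hp]
end
end Apx

namespace Apx
set_option linter.unusedSectionVars false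
section
variable {G H : Type} [AddCommGroup G] [AddCommGroup H] [Fintype G]

open Classical in
noncomputable def u (f : G → H) (z a : G) : ℝ := if f z = f a + f (z - a) then 1 else 0

noncomputable def nz (f : G → H) (z : G) : ℝ := ∑ a, u f z a

noncomputable def tot (f : G → H) : ℝ := ∑ z, nz f z

noncomputable def mu (f : G → H) (ω : G × G × G × G) : ℝ :=
  u f ω.1 ω.2.1 * u f ω.1 ω.2.2.1 * u f ω.1 ω.2.2.2 / (tot f * nz f ω.1 ^ 2)

noncomputable def lam (f : G → H) : ℝ := ∑ ω, mu f ω * Real.log (nz f ω.1)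

def gam (f : G → H) (x : G) : G × H := (x, f x)

lemma gam_inj (f : G → H) {x y : G} (h : gam f x = gam f y) : x = y := congrArg Prod.fst h

lemma u_nonneg (f : G → H) (z a : G) : 0 ≤ u f z a := by
  unfold u; split_ifs <;> norm_num

lemma u_eq_one {f : G → H} {z a : G} (h : u f z a ≠ 0) : u f z a = 1 := by
  unfold u at *; split_ifs at * <;> simp_all

lemma gam_of_u {f : G → H} {z a : G} (h : u f z a ≠ 0) : gam f z = gam f a + gam f (z - a) := by
  unfold u at h
  split_ifs at h with h'
  · simp [gam, h']
  · exact absurd rfl h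

lemma nz_nonneg (f : G → H) (z : G) : 0 ≤ nz f z := Finset.sum_nonneg fun _ _ => u_nonneg f z _

lemma nz_pos {f : G → H} {z a : G} (h : u f z a ≠ 0) : 0 < nz f z := by
  have h1 := Finset.single_le_sum (f := fun a => u f z a) (s := Finset.univ)
    (fun i _ => u_nonneg f z i) (Finset.mem_univ a)
  have h2 := u_eq_one h
  simp only [h2] at h1
  unfold nz
  linarith

variable {f : G → H}

lemma tot_nonneg : 0 ≤ tot f := Finset.sum_nonneg fun _ _ => nz_nonneg f _

lemma mu_nonneg (ω : G × G × G × G) : 0 ≤ mu f ω := by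
  unfold mu
  have := u_nonneg f ω.1 ω.2.1
  have := u_nonneg f ω.1 ω.2.2.1
  have := u_nonneg f ω.1 ω.2.2.2
  have := tot_nonneg (f := f)
  positivity

lemma supp {ω : G × G × G × G} (h : mu f ω ≠ 0) :
    u f ω.1 ω.2.1 ≠ 0 ∧ u f ω.1 ω.2.2.1 ≠ 0 ∧ u f ω.1 ω.2.2.2 ≠ 0 := by
  unfold mu at h
  refine ⟨?_, ?_, ?_⟩ <;> intro h' <;> simp [h'] at h

lemma nz_mul (z : G) (x : ℝ) (hx : nz f z = 0 → x = 0) :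
    nz f z * (x / (tot f * nz f z ^ 2)) = x / (tot f * nz f z) := by
  by_cases h : nz f z = 0
  · simp [h, hx h]
  · by_cases ht : tot f = 0
    · simp [ht]
    · field_simp

lemma sum_c (z a b : G) : ∑ c, mu f (z, a, b, c) = u f z a * u f z b / (tot f * nz f z) := by
  have : ∀ c, mu f (z, a, b, c) = u f z c * ((u f z a * u f z b) / (tot f * nz f z ^ 2)) := by
    intro c; simp only [mu]; ring
  rw [Finset.sum_congr rfl fun c _ => this c, ← Finset.sum_mul]
  apply nz_mul
  intro h
  by_contra h'
  have := nz_pos (left_ne_zero_of_mul h')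
  linarith

lemma sum_bc (z a : G) : ∑ b, ∑ c, mu f (z, a, b, c) = u f z a / tot f := by
  simp only [sum_c]
  have : ∀ b, u f z a * u f z b / (tot f * nz f z) = u f z b * (u f z a / (tot f * nz f z)) := by
    intro c; ring
  rw [Finset.sum_congr rfl fun c _ => this c, ← Finset.sum_mul]
  change nz f z * _ = _
  by_cases h : nz f z = 0
  · have : u f z a = 0 := by
      by_contra h'
      have := nz_pos h'
      linarith
    simp [this]
  · by_cases ht : tot f = 0
    · simp [ht]
    · field_simp

lemma sum_abc (z : G) : ∑ a, ∑ b, ∑ c, mu f (z, a, b, c) = nz f z / tot f := by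
  simp only [sum_bc, ← Finset.sum_div]; rfl

lemma sum_mu (ht : 0 < tot f) : ∑ ω, mu f ω = 1 := by
  simp only [Fintype.sum_prod_type, sum_abc, ← Finset.sum_div]
  exact div_self ht.ne'

lemma pr_z (ω : G × G × G × G) : pr (mu f) (fun ω => ω.1) ω = nz f ω.1 / tot f := by
  classical
  rw [← sum_abc]
  simp only [pr, Fintype.sum_prod_type]
  rw [Finset.sum_eq_single ω.1]
  · simp
  · intro b _ hb; simp [hb]
  · simp

lemma pr_za (ω : G × G × G × G) : pr (mu f) (fun ω => (ω.1, ω.2.1)) ω = u f ω.1 ω.2.1 / tot f := by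
  classical
  rw [← sum_bc]
  simp only [pr, Fintype.sum_prod_type]
  rw [Finset.sum_eq_single ω.1, Finset.sum_eq_single ω.2.1]
  · simp
  · intro b _ hb; simp [hb]
  · simp
  · intro b _ hb; simp [hb]
  · simp

lemma pr_zab (ω : G × G × G × G) : pr (mu f) (fun ω => (ω.1, ω.2.1, ω.2.2.1)) ω =
    u f ω.1 ω.2.1 * u f ω.1 ω.2.2.1 / (tot f * nz f ω.1) := by
  classical
  rw [← sum_c]
  simp only [pr, Fintype.sum_prod_type]
  rw [Finset.sum_eq_single ω.1, Finset.sum_eq_single ω.2.1, Finset.sum_eq_single ω.2.2.1]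
  · simp
  · intro b _ hb; simp [hb]
  · simp
  · intro b _ hb; simp [hb]
  · simp
  · intro b _ hb; simp [hb]
  · simp

lemma pr_zabc (ω : G × G × G × G) : pr (mu f) (fun ω => ω) ω = mu f ω := by
  classical
  unfold pr
  rw [Finset.sum_eq_single ω]
  · simp
  · intro b _ hb; simp [hb]
  · simp

lemma ent_aux (ht : 0 < tot f) {T : Type} (φ : G × G × G × G → T) (k : ℝ)
    (h : ∀ ω, mu f ω ≠ 0 → -Real.log (pr (mu f) φ ω) = Real.log (tot f) + k * Real.log (nz f ω.1)) :
    ent (mu f) φ = Real.log (tot f) + k * lam f := by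
  have : ∀ ω, mu f ω * (-Real.log (pr (mu f) φ ω)) =
      mu f ω * Real.log (tot f) + k * (mu f ω * Real.log (nz f ω.1)) := by
    intro ω
    by_cases hm : mu f ω = 0
    · simp [hm]
    · rw [h ω hm]; ring
  unfold ent lam
  rw [Finset.sum_congr rfl fun ω _ => this ω, Finset.sum_add_distrib, ← Finset.sum_mul,
    ← Finset.mul_sum, sum_mu ht, one_mul]

lemma ent_z (ht : 0 < tot f) : ent (mu f) (fun ω => ω.1) = Real.log (tot f) - lam f := by
  rw [ent_aux ht _ (-1)]
  · ring
  · intro ω hm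
    have hn := nz_pos (supp hm).1
    rw [pr_z, Real.log_div hn.ne' ht.ne']; ring

lemma ent_za (ht : 0 < tot f) : ent (mu f) (fun ω => (ω.1, ω.2.1)) = Real.log (tot f) := by
  rw [ent_aux ht _ 0]
  · ring
  · intro ω hm
    rw [pr_za, u_eq_one (supp hm).1, Real.log_div one_ne_zero ht.ne', Real.log_one]; ring

lemma ent_zab (ht : 0 < tot f) :
    ent (mu f) (fun ω => (ω.1, ω.2.1, ω.2.2.1)) = Real.log (tot f) + lam f := by
  rw [ent_aux ht _ 1]
  · ring
  · intro ω hm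
    have hn := nz_pos (supp hm).1
    rw [pr_zab, u_eq_one (supp hm).1, u_eq_one (supp hm).2.1, one_mul,
      Real.log_div one_ne_zero (by positivity), Real.log_mul ht.ne' hn.ne', Real.log_one]; ring

lemma ent_zabc (ht : 0 < tot f) :
    ent (mu f) (fun ω => ω) = Real.log (tot f) + 2 * lam f := by
  apply ent_aux ht _ 2
  intro ω hm
  have hn := nz_pos (supp hm).1
  rw [pr_zabc, mu, u_eq_one (supp hm).1, u_eq_one (supp hm).2.1, u_eq_one (supp hm).2.2, one_mul,
      one_mul, Real.log_div one_ne_zero (by positivity), Real.log_mul ht.ne' (by positivity),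
      Real.log_one, Real.log_pow]
  push_cast
  ring

/-- conditional entropy of an integer combination -/
noncomputable def ec (f : G → H) (i j k : ℤ) : ℝ :=
  ent (mu f) (fun ω => (i • gam f ω.2.1 + j • gam f ω.2.2.1 + k • gam f ω.2.2.2, ω.1))
    - ent (mu f) (fun ω => ω.1)

def swap12 : G × G × G × G ≃ G × G × G × G where
  toFun ω := (ω.1, ω.2.2.1, ω.2.1, ω.2.2.2)
  invFun ω := (ω.1, ω.2.2.1, ω.2.1, ω.2.2.2)
  left_inv _ := rfl
  right_inv _ := rfl

def swap23 : G × G × G × G ≃ G × G × G × G where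
  toFun ω := (ω.1, ω.2.1, ω.2.2.2, ω.2.2.1)
  invFun ω := (ω.1, ω.2.1, ω.2.2.2, ω.2.2.1)
  left_inv _ := rfl
  right_inv _ := rfl

lemma mu_swap12 (ω : G × G × G × G) : mu f (swap12 ω) = mu f ω := by
  simp only [mu, swap12, Equiv.coe_fn_mk]; ring

lemma mu_swap23 (ω : G × G × G × G) : mu f (swap23 ω) = mu f ω := by
  simp only [mu, swap23, Equiv.coe_fn_mk]; ring

lemma ec_swap12 (i j k : ℤ) : ec f i j k = ec f j i k := by
  unfold ec
  rw [← ent_comp swap12 mu_swap12]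
  congr 2
  funext ω
  simp only [swap12, Equiv.coe_fn_mk]
  rw [add_comm (i • _)]

lemma ec_swap23 (i j k : ℤ) : ec f i j k = ec f i k j := by
  unfold ec
  rw [← ent_comp swap23 mu_swap23]
  congr 2
  funext ω
  simp only [swap23, Equiv.coe_fn_mk]
  rw [add_right_comm]

lemma ec_neg (ht : 0 < tot f) (i j k : ℤ) : ec f (-i) (-j) (-k) = ec f i j k := by
  unfold ec
  congr 1
  have hneg : ∀ ω : G × G × G × G,
      (-i) • gam f ω.2.1 + (-j) • gam f ω.2.2.1 + (-k) • gam f ω.2.2.2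
      = -(i • gam f ω.2.1 + j • gam f ω.2.2.1 + k • gam f ω.2.2.2) := by
    intro ω; simp only [neg_smul]; abel
  simp only [hneg]
  apply le_antisymm <;> apply ent_mono mu_nonneg (sum_mu ht) <;> intro ω ω' _ _ h <;>
    simp only [Prod.mk.injEq, neg_inj] at h ⊢ <;> exact h

lemma ent_pair (ht : 0 < tot f) {T S : Type} (φ : G × G × G × G → T) (ψ : G × G × G × G → S) :
    ent (mu f) (fun ω => (φ ω, ψ ω, ω.1)) + ent (mu f) (fun ω => ω.1) ≤
      ent (mu f) (fun ω => (φ ω, ω.1)) + ent (mu f) (fun ω => (ψ ω, ω.1)) := by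
  apply submod mu_nonneg (sum_mu ht)
  · intro ω ω' _ _ h; exact congrArg Prod.snd h
  · intro ω ω' _ _ h; exact congrArg Prod.snd h
  · intro ω ω' _ _ h
    simp only [Prod.mk.injEq] at h ⊢
    tauto

lemma ruzsa (ht : 0 < tot f) (i j l k : ℤ) :
    ec f i (j + l * k) 0 ≤ ec f 0 k 1 + ec f i j (-l) - lam f := by
  have h1 := ent_pair ht (fun ω => (0:ℤ) • gam f ω.2.1 + k • gam f ω.2.2.1 + (1:ℤ) • gam f ω.2.2.2)
    (fun ω => i • gam f ω.2.1 + j • gam f ω.2.2.1 + (-l) • gam f ω.2.2.2)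
  have h2 := submod mu_nonneg (sum_mu ht)
    (fun ω => ((0:ℤ) • gam f ω.2.1 + k • gam f ω.2.2.1 + (1:ℤ) • gam f ω.2.2.2,
      i • gam f ω.2.1 + j • gam f ω.2.2.1 + (-l) • gam f ω.2.2.2, ω.1))
    (fun ω => (ω.1, ω.2.1, ω.2.2.1))
    (fun ω => (i • gam f ω.2.1 + (j + l * k) • gam f ω.2.2.1 + (0:ℤ) • gam f ω.2.2.2, ω.1))
    (fun ω => ω) ?_ ?_ ?_
  · have e1 := ent_zabc ht
    have e2 := ent_zab ht
    have e3 := ent_z ht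
    unfold ec
    linarith
  · intro ω ω' _ _ h
    simp only [Prod.mk.injEq] at h ⊢
    refine ⟨?_, h.2.2⟩
    have : ∀ ω : G × G × G × G,
        i • gam f ω.2.1 + (j + l * k) • gam f ω.2.2.1 + (0:ℤ) • gam f ω.2.2.2 =
        (i • gam f ω.2.1 + j • gam f ω.2.2.1 + (-l) • gam f ω.2.2.2) +
        l • ((0:ℤ) • gam f ω.2.1 + k • gam f ω.2.2.1 + (1:ℤ) • gam f ω.2.2.2) := by
      intro ω; module
    rw [this, this, h.1, h.2.1]
  · intro ω ω' _ _ h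
    simp only [Prod.mk.injEq] at h ⊢
    rw [h.1, h.2.1, h.2.2]
    simp
  · intro ω ω' _ _ h
    simp only [Prod.mk.injEq] at h
    obtain ⟨⟨h1, -, -⟩, h3, h4, h5⟩ := h
    rw [h4, h5] at h1
    simp only [one_smul, add_right_inj] at h1
    exact Prod.ext h3 (Prod.ext h4 (Prod.ext h5 (gam_inj f h1)))

lemma kvm (ht : 0 < tot f) (i k : ℤ) :
    ec f i 1 k ≤ ec f i 1 0 + ec f 0 1 k - lam f := by
  have h1 := ent_pair ht (fun ω => ω.2.1)
    (fun ω => (0:ℤ) • gam f ω.2.1 + (1:ℤ) • gam f ω.2.2.1 + k • gam f ω.2.2.2)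
  have h1' := ent_pair ht (fun ω => ω.2.2.2)
    (fun ω => i • gam f ω.2.1 + (1:ℤ) • gam f ω.2.2.1 + (0:ℤ) • gam f ω.2.2.2)
  have h2 := submod mu_nonneg (sum_mu ht)
    (fun ω => (ω.2.1, (0:ℤ) • gam f ω.2.1 + (1:ℤ) • gam f ω.2.2.1 + k • gam f ω.2.2.2, ω.1))
    (fun ω => (ω.2.2.2, i • gam f ω.2.1 + (1:ℤ) • gam f ω.2.2.1 + (0:ℤ) • gam f ω.2.2.2, ω.1))
    (fun ω => (i • gam f ω.2.1 + (1:ℤ) • gam f ω.2.2.1 + k • gam f ω.2.2.2, ω.1))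
    (fun ω => ω) ?_ ?_ ?_
  · have e1 := ent_zabc ht
    have e2 : ent (mu f) (fun ω => (ω.2.1, ω.1)) ≤ Real.log (tot f) := by
      rw [← ent_za ht]
      apply ent_mono mu_nonneg (sum_mu ht)
      intro ω ω' _ _ h
      simp only [Prod.mk.injEq] at h ⊢
      tauto
    have e2' : ent (mu f) (fun ω => (ω.2.2.2, ω.1)) ≤ Real.log (tot f) := by
      refine le_trans (le_of_eq ?_) e2
      rw [← ent_comp swap12 mu_swap12 (fun ω => (ω.2.1, ω.1)), ← ent_comp swap23 mu_swap23]
      rfl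
    have e3 := ent_z ht
    unfold ec
    linarith
  · intro ω ω' _ _ h
    simp only [Prod.mk.injEq] at h ⊢
    refine ⟨?_, h.2.2⟩
    have : ∀ ω : G × G × G × G,
        i • gam f ω.2.1 + (1:ℤ) • gam f ω.2.2.1 + k • gam f ω.2.2.2 =
        i • gam f ω.2.1 + ((0:ℤ) • gam f ω.2.1 + (1:ℤ) • gam f ω.2.2.1 + k • gam f ω.2.2.2) := by
      intro ω; module
    rw [this, this, h.2.1, h.1]
  · intro ω ω' _ _ h
    simp only [Prod.mk.injEq] at h ⊢
    refine ⟨?_, h.2.2⟩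
    have : ∀ ω : G × G × G × G,
        i • gam f ω.2.1 + (1:ℤ) • gam f ω.2.2.1 + k • gam f ω.2.2.2 =
        (i • gam f ω.2.1 + (1:ℤ) • gam f ω.2.2.1 + (0:ℤ) • gam f ω.2.2.2) + k • gam f ω.2.2.2 := by
      intro ω; module
    rw [this, this, h.2.1, h.1]
  · intro ω ω' _ _ h
    simp only [Prod.mk.injEq] at h
    obtain ⟨⟨h1, h2, h3⟩, h4, -, -⟩ := h
    rw [h1, h4] at h2
    simp only [one_smul, add_left_inj, add_right_inj] at h2
    exact Prod.ext h3 (Prod.ext h1 (Prod.ext (gam_inj f h2) h4))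

/-- log of the number of elements -/
noncomputable def del (f : G → H) : ℝ := 2 * Real.log (Fintype.card G) - Real.log (tot f)

lemma lam_ge (ht : 0 < tot f) : Real.log (Fintype.card G) - del f ≤ lam f := by
  have := ent_z ht
  have h2 := ent_le_log_card mu_nonneg (sum_mu ht) (fun ω => ω.1)
  unfold del
  linarith

lemma pair_le (ht : 0 < tot f) (φ : G × G × G × G → G × G) :
    ent (mu f) φ ≤ 2 * Real.log (Fintype.card G) := by
  have h2 := ent_le_log_card mu_nonneg (sum_mu ht) φ
  have hc : (Fintype.card G : ℝ) ≠ 0 := by exact_mod_cast Fintype.card_ne_zero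
  rw [Fintype.card_prod, Nat.cast_mul, Real.log_mul hc hc] at h2
  linarith

lemma del_nonneg (ht : 0 < tot f) : 0 ≤ del f := by
  have := pair_le ht (fun ω => (ω.1, ω.2.1))
  rw [ent_za ht] at this
  unfold del
  linarith

lemma bsg_plus (ht : 0 < tot f) : ec f 1 1 0 - lam f ≤ 3 * del f := by
  have h1 := submod mu_nonneg (sum_mu ht)
    (fun ω => (ω.2.1, ω.1 - ω.2.2.1)) (fun ω => (ω.2.2.1, ω.1 - ω.2.1))
    (fun ω => gam f ω.2.1 - gam f (ω.1 - ω.2.2.1))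
    (fun ω => (ω.1, ω.2.1, ω.2.2.1)) ?_ ?_ ?_
  · have h2 := subadd mu_nonneg (sum_mu ht) (fun ω => gam f ω.2.1 - gam f (ω.1 - ω.2.2.1))
      (fun ω => ω.1)
      (fun ω => ((1:ℤ) • gam f ω.2.1 + (1:ℤ) • gam f ω.2.2.1 + (0:ℤ) • gam f ω.2.2.2, ω.1)) ?_
    · have h3 := pair_le ht (fun ω => (ω.2.1, ω.1 - ω.2.2.1))
      have h4 := pair_le ht (fun ω => (ω.2.2.1, ω.1 - ω.2.1))
      have h5 := lam_ge ht
      have e2 := ent_zab ht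
      have e3 := ent_z ht
      unfold ec
      unfold del at *
      linarith
    · intro ω ω' hm hm' h
      simp only [Prod.mk.injEq] at h ⊢
      obtain ⟨h1, h2⟩ := h
      refine ⟨?_, h2⟩
      have k1 := gam_of_u (supp hm).2.1
      have k2 := gam_of_u (supp hm').2.1
      rw [← sub_eq_iff_eq_add'] at k1 k2
      rw [← k1, ← k2, h2] at h1
      simp only [one_smul, zero_smul, add_zero]
      have := congrArg (fun x => x + gam f ω'.1) h1
      rw [show gam f ω.2.1 - (gam f ω'.1 - gam f ω.2.2.1) + gam f ω'.1 =
        gam f ω.2.1 + gam f ω.2.2.1 by abel,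
        show gam f ω'.2.1 - (gam f ω'.1 - gam f ω'.2.2.1) + gam f ω'.1 =
        gam f ω'.2.1 + gam f ω'.2.2.1 by abel] at this
      exact this
  · intro ω ω' _ _ h
    simp only [Prod.mk.injEq] at h ⊢
    rw [h.1, h.2]
  · intro ω ω' hm hm' h
    simp only [Prod.mk.injEq] at h ⊢
    have key : ∀ ω, mu f ω ≠ 0 → gam f ω.2.1 - gam f (ω.1 - ω.2.2.1) =
        gam f ω.2.2.1 - gam f (ω.1 - ω.2.1) := by
      intro ω hm
      have k1 := gam_of_u (supp hm).1
      have k2 := gam_of_u (supp hm).2.1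
      rw [sub_eq_sub_iff_add_eq_add, ← k1, ← k2]
    rw [key ω hm, key ω' hm', h.1, h.2]
  · intro ω ω' _ _ h
    simp only [Prod.mk.injEq] at h ⊢
    obtain ⟨⟨h1, h2⟩, h3, h4⟩ := h
    refine ⟨?_, h1, h3⟩
    rw [h3] at h2
    exact sub_left_injective h2

lemma bsg_minus (ht : 0 < tot f) : ec f 1 (-1) 0 - lam f ≤ 3 * del f := by
  have h1 := submod mu_nonneg (sum_mu ht)
    (fun ω => (ω.2.1, ω.2.2.1)) (fun ω => (ω.1 - ω.2.2.1, ω.1 - ω.2.1))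
    (fun ω => gam f ω.2.1 - gam f ω.2.2.1)
    (fun ω => (ω.1, ω.2.1, ω.2.2.1)) ?_ ?_ ?_
  · have h2 := subadd mu_nonneg (sum_mu ht) (fun ω => gam f ω.2.1 - gam f ω.2.2.1)
      (fun ω => ω.1)
      (fun ω => ((1:ℤ) • gam f ω.2.1 + (-1:ℤ) • gam f ω.2.2.1 + (0:ℤ) • gam f ω.2.2.2, ω.1)) ?_
    · have h3 := pair_le ht (fun ω => (ω.2.1, ω.2.2.1))
      have h4 := pair_le ht (fun ω => (ω.1 - ω.2.2.1, ω.1 - ω.2.1))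
      have h5 := lam_ge ht
      have e2 := ent_zab ht
      have e3 := ent_z ht
      unfold ec
      unfold del at *
      linarith
    · intro ω ω' hm hm' h
      simp only [Prod.mk.injEq] at h ⊢
      obtain ⟨h1, h2⟩ := h
      refine ⟨?_, h2⟩
      simp only [one_smul, zero_smul, add_zero, neg_smul, ← sub_eq_add_neg]
      exact h1
  · intro ω ω' _ _ h
    simp only [Prod.mk.injEq] at h ⊢
    rw [h.1, h.2]
  · intro ω ω' hm hm' h
    simp only [Prod.mk.injEq] at h ⊢
    have key : ∀ ω, mu f ω ≠ 0 → gam f ω.2.1 - gam f ω.2.2.1 =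
        gam f (ω.1 - ω.2.2.1) - gam f (ω.1 - ω.2.1) := by
      intro ω hm
      have k1 := gam_of_u (supp hm).1
      have k2 := gam_of_u (supp hm).2.1
      rw [sub_eq_sub_iff_add_eq_add, ← k1, k2, add_comm]
    rw [key ω hm, key ω' hm', h.1, h.2]
  · intro ω ω' _ _ h
    simp only [Prod.mk.injEq] at h ⊢
    obtain ⟨⟨h1, h2⟩, h3, h4⟩ := h
    refine ⟨?_, h1, h2⟩
    rw [h2] at h3
    exact sub_left_injective h3

lemma ec_zero (ht : 0 < tot f) : ec f 1 0 0 ≤ lam f := by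
  have : ent (mu f) (fun ω => ((1:ℤ) • gam f ω.2.1 + (0:ℤ) • gam f ω.2.2.1
      + (0:ℤ) • gam f ω.2.2.2, ω.1)) ≤ ent (mu f) (fun ω => (ω.1, ω.2.1)) := by
    apply ent_mono mu_nonneg (sum_mu ht)
    intro ω ω' _ _ h
    simp only [Prod.mk.injEq] at h ⊢
    rw [h.1, h.2]; simp
  have e1 := ent_za ht
  have e2 := ent_z ht
  unfold ec
  linarith

lemma ec_m2 (ht : 0 < tot f) : ec f 1 (-2) 0 ≤ lam f + 9 * del f := by
  have hp := bsg_plus ht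
  have hm := bsg_minus ht
  have h1 := ruzsa ht 1 (-1) 1 (-1)
  norm_num at h1
  have e1 : ec f 0 (-1) 1 = ec f 1 (-1) 0 := by
    rw [ec_swap12, ec_swap23, ec_swap12]
  have e2 : ec f 1 (-1) (-1) = ec f 1 1 (-1) := by
    rw [← ec_neg ht, neg_neg, ec_swap12, ec_swap23]
  have e3 : ec f 0 1 (-1) = ec f 1 (-1) 0 := by
    rw [ec_swap12, ec_swap23]
  have h2 := kvm ht 1 (-1)
  linarith

lemma ec_2 (ht : 0 < tot f) : ec f 1 2 0 ≤ lam f + 9 * del f := by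
  have hp := bsg_plus ht
  have hm := bsg_minus ht
  have h1 := ruzsa ht 1 1 1 1
  norm_num at h1
  have e1 : ec f 0 1 1 = ec f 1 1 0 := by
    rw [ec_swap12, ec_swap23]
  have e3 : ec f 0 1 (-1) = ec f 1 (-1) 0 := by
    rw [ec_swap12, ec_swap23]
  have h2 := kvm ht 1 (-1)
  linarith

lemma ec_even (ht : 0 < tot f) (q : ℤ) : ec f 1 (2 * q) 0 ≤ ec f 1 q 0 + 9 * del f := by
  have h1 := ruzsa ht 1 0 2 q
  have h2 := ec_m2 ht
  rw [zero_add] at h1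
  have e1 : ec f 0 q 1 = ec f 1 q 0 := by
    rw [ec_swap12, ec_swap23, ec_swap12]
  have e2 : ec f 1 0 (-2) = ec f 1 (-2) 0 := ec_swap23 _ _ _
  linarith

lemma ec_odd (ht : 0 < tot f) (q : ℤ) : ec f 1 (2 * q + 1) 0 ≤ ec f 1 q 0 + 12 * del f := by
  have h1 := ruzsa ht 1 1 2 q
  have h2 := ec_m2 ht
  have hp := bsg_plus ht
  have h3 := kvm ht 1 (-2)
  rw [add_comm] at h1
  have e1 : ec f 0 q 1 = ec f 1 q 0 := by
    rw [ec_swap12, ec_swap23, ec_swap12]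
  have e2 : ec f 0 1 (-2) = ec f 1 (-2) 0 := by
    rw [ec_swap12, ec_swap23]
  rw [add_comm] at h1
  rw [add_comm 1 (2 * q)] at h1
  linarith

lemma ec_lin (ht : 0 < tot f) (r : ℕ) : ec f 1 r 0 ≤ lam f + 5 * r * del f := by
  have hd := del_nonneg ht
  induction r using Nat.strong_induction_on with
  | _ r ih =>
    rcases Nat.lt_or_ge r 3 with h | h
    · interval_cases r
      · have := ec_zero ht
        simpa using this
      · have := bsg_plus ht
        push_cast
        linarith
      · have := ec_2 ht
        push_cast
        linarith
    · obtain ⟨q, hq | hq⟩ : ∃ q, r = 2 * q ∨ r = 2 * q + 1 := ⟨r / 2, by omega⟩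
      · have h1 := ih q (by omega)
        have h2 := ec_even ht (q : ℤ)
        have hq2 : (2 : ℝ) ≤ q := by exact_mod_cast (by omega : 2 ≤ q)
        subst hq
        push_cast
        nlinarith
      · rcases Nat.lt_or_ge q 2 with h' | h'
        · have : q = 1 := by omega
          subst this
          subst hq
          have h2 := ec_odd ht 1
          have := bsg_plus ht
          norm_num at h2 ⊢
          linarith
        · have h1 := ih q (by omega)
          have h2 := ec_odd ht (q : ℤ)
          have hq2 : (2 : ℝ) ≤ q := by exact_mod_cast h'
          subst hq
          push_cast
          nlinarith

lemma ec_log (ht : 0 < tot f) (r : ℕ) :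
    ec f 1 r 0 ≤ lam f + (18 * (Nat.log 2 r : ℝ) + 6) * del f := by
  have hd := del_nonneg ht
  induction r using Nat.strong_induction_on with
  | _ r ih =>
    rcases Nat.lt_or_ge r 2 with h | h
    · interval_cases r
      · have := ec_zero ht
        simp
        linarith
      · have := bsg_plus ht
        simp
        linarith
    · have hl : Nat.log 2 r = Nat.log 2 (r / 2) + 1 := Nat.log_of_one_lt_of_le (by norm_num) h
      have h1 := ih (r / 2) (by omega)
      have hr : r = 2 * (r / 2) ∨ r = 2 * (r / 2) + 1 := by omega
      have h3 : ec f 1 r 0 ≤ ec f 1 ((r / 2 : ℕ) : ℤ) 0 + 12 * del f := by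
        rcases hr with hr | hr
        · have h2 := ec_even ht ((r / 2 : ℕ) : ℤ)
          have e : (r : ℤ) = 2 * ((r / 2 : ℕ) : ℤ) := by exact_mod_cast hr
          rw [← e] at h2
          linarith
        · have h2 := ec_odd ht ((r / 2 : ℕ) : ℤ)
          have e : (r : ℤ) = 2 * ((r / 2 : ℕ) : ℤ) + 1 := by exact_mod_cast hr
          rw [← e] at h2
          linarith
      rw [hl]
      push_cast
      linarith

/-- lower bound for the entropy of `a + r b` -/
lemma lower (ht : 0 < tot f) (r : ℕ) {T : Type} [Fintype T] [Nonempty T]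
    (κ : G → T)
    (hκ : ∀ a b a' b', gam f a + r • gam f b = gam f a' + r • gam f b' → κ b = κ b' →
      a = a' ∧ b = b') :
    lam f ≤ (ec f 1 r 0 - lam f) + Real.log (Fintype.card T) := by
  have h1 := subadd mu_nonneg (sum_mu ht)
    (fun ω => ((1:ℤ) • gam f ω.2.1 + (r:ℤ) • gam f ω.2.2.1 + (0:ℤ) • gam f ω.2.2.2, ω.1))
    (fun ω => κ ω.2.2.1) (fun ω => (ω.1, ω.2.1, ω.2.2.1)) ?_
  · have h2 := ent_le_log_card mu_nonneg (sum_mu ht) (fun ω => κ ω.2.2.1)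
    have e2 := ent_zab ht
    have e3 := ent_z ht
    unfold ec
    linarith
  · intro ω ω' _ _ h
    simp only [Prod.mk.injEq, one_smul, zero_smul, add_zero, natCast_zsmul] at h ⊢
    exact ⟨h.1.2, hκ _ _ _ _ h.1.1 h.2⟩

end
end Apx

namespace Apx
section
variable {G H : Type} [AddCommGroup G] [AddCommGroup H] [Fintype G] {f : G → H}

lemma tot_eq : tot f = (Nat.card {xy : G × G // f (xy.1 + xy.2) = f xy.1 + f xy.2} : ℝ) := by
  classical
  rw [Nat.card_eq_fintype_card, Fintype.card_subtype, Finset.card_filter, Fintype.sum_prod_type]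
  push_cast
  unfold tot nz
  rw [Finset.sum_comm]
  apply Finset.sum_congr rfl
  intro a _
  rw [← Equiv.sum_comp (Equiv.addLeft a)]
  apply Finset.sum_congr rfl
  intro y _
  simp [u]

lemma final (hf0 : 0 < tot f) (r : ℕ) {T : Type} [Finite T] [Nonempty T]
    (κ : G → T)
    (hκ : ∀ a b a' b', gam f a + r • gam f b = gam f a' + r • gam f b' → κ b = κ b' →
      a = a' ∧ b = b') (α : ℝ) (hα : 0 < α)
    (hle : α ≤ max (1 / (5 * (r : ℝ) + 1)) (1 / (18 * (Nat.log 2 r : ℝ) + 7))) :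
    tot f / (Nat.card G : ℝ) ^ 2 ≤ ((Nat.card T : ℝ) / (Nat.card G : ℝ)) ^ α := by
  haveI := Fintype.ofFinite T
  have hn : (0 : ℝ) < Nat.card G := by exact_mod_cast Nat.card_pos
  have hT : (0 : ℝ) < Nat.card T := by exact_mod_cast Nat.card_pos
  have h1 := lower hf0 r κ hκ
  have h2 := lam_ge hf0
  have h3 := ec_lin hf0 r
  have h4 := ec_log hf0 r
  have hd := del_nonneg hf0
  have hdel : del f = 2 * Real.log (Nat.card G) - Real.log (tot f) := by
    rw [Nat.card_eq_fintype_card]; rfl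
  rw [← Nat.card_eq_fintype_card] at h1 h2
  set D := Real.log (Nat.card G) - Real.log (Nat.card T) with hD
  have key : α * D ≤ del f := by
    rcases le_or_gt D 0 with hneg | hpos
    · nlinarith
    · rcases le_max_iff.1 hle with h | h
      · have hM : (0 : ℝ) < 5 * r + 1 := by positivity
        have a1 : α * (5 * r + 1) ≤ 1 := by
          rwa [le_div_iff₀ hM] at h
        have a2 : D ≤ (5 * r + 1) * del f := by rw [hD]; linarith
        nlinarith
      · have hM : (0 : ℝ) < 18 * (Nat.log 2 r : ℝ) + 7 := by positivity
        have a1 : α * (18 * (Nat.log 2 r : ℝ) + 7) ≤ 1 := by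
          rwa [le_div_iff₀ hM] at h
        have a2 : D ≤ (18 * (Nat.log 2 r : ℝ) + 7) * del f := by rw [hD]; linarith
        nlinarith
  rw [Real.rpow_def_of_pos (by positivity), ← Real.log_le_iff_le_exp (by positivity),
    Real.log_div hf0.ne' (by positivity), Real.log_div hT.ne' hn.ne', Real.log_pow]
  push_cast
  linarith
end
end Apx

open Apx in
theorem stmt_4 :
    ∃ C : ℝ, 0 < C ∧
      ∀ (G H : Type) [AddCommGroup G] [AddCommGroup H] [Fintype G] (r : ℕ),
        (Set.range (fun h : H => r • h)).Finite →
        ({h : H | r • h = 0}).Finite →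
        ∀ f : G → H, Function.Injective f →
          ∀ α : ℝ, 0 < α →
            α ≤ max (1 / (5 * (r : ℝ) + 1)) (1 / (18 * (Nat.log 2 r : ℝ) + 7)) →
            (Nat.card {xy : G × G // f (xy.1 + xy.2) = f xy.1 + f xy.2} : ℝ) / (Nat.card G : ℝ) ^ 2
              ≤ (C * min
                    ((Nat.card (Set.range (fun g : G => r • g)) : ℝ) *
                      (Nat.card {h : H | r • h = 0} : ℝ))
                    ((Nat.card (Set.range (fun h : H => r • h)) : ℝ) *
                      (Nat.card {g : G | r • g = 0} : ℝ))
                  / (Nat.card G : ℝ)) ^ α := by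
  refine ⟨1, one_pos, ?_⟩
  intro G H _ _ _ r hr hk f hf α hα hle
  rw [one_mul, ← tot_eq]
  rcases eq_or_lt_of_le (tot_nonneg (f := f)) with h0 | h0
  · rw [← h0, zero_div]
    positivity
  haveI : Finite (Set.range (fun h : H => r • h)) := hr
  haveI : Finite {h : H | r • h = 0} := hk
  have secH : ∃ s : H → H, ∀ h, r • (s (r • h)) = r • h :=
    ⟨fun y => Function.invFun (fun h : H => r • h) y, fun h =>
      Function.invFun_eq (f := fun h : H => r • h) ⟨h, rfl⟩⟩
  have secG : ∃ s : G → G, ∀ h, r • (s (r • h)) = r • h :=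
    ⟨fun y => Function.invFun (fun h : G => r • h) y, fun h =>
      Function.invFun_eq (f := fun h : G => r • h) ⟨h, rfl⟩⟩
  rcases min_choice ((Nat.card (Set.range (fun g : G => r • g)) : ℝ) *
                      (Nat.card {h : H | r • h = 0} : ℝ))
                    ((Nat.card (Set.range (fun h : H => r • h)) : ℝ) *
                      (Nat.card {g : G | r • g = 0} : ℝ)) with hm | hm
  · rw [hm]
    obtain ⟨s, hs⟩ := secH
    haveI : Nonempty (Set.range (fun g : G => r • g) × {h : H | r • h = 0}) :=
      ⟨(⟨r • 0, 0, rfl⟩, ⟨0, smul_zero r⟩)⟩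
    have := final h0 r (T := Set.range (fun g : G => r • g) × {h : H | r • h = 0})
      (fun b => (⟨r • b, b, rfl⟩, ⟨f b - s (r • f b), by
        simp [smul_sub, hs]⟩)) ?_ α hα hle
    · rw [Nat.card_prod] at this
      push_cast at this
      exact this
    · intro a b a' b' h1 h2
      simp only [gam, Prod.smul_mk, Prod.mk_add_mk, Prod.mk.injEq, Subtype.mk.injEq] at h1 h2
      obtain ⟨h3, h4⟩ := h1
      obtain ⟨h5s, h6s⟩ := h2
      have h5 : r • b = r • b' := congrArg Subtype.val h5s
      have h6 : f b - s (r • f b) = f b' - s (r • f b') := h6s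
      rw [h5, add_left_inj] at h3
      subst h3
      rw [add_right_inj] at h4
      rw [h4, sub_left_inj] at h6
      exact ⟨rfl, hf h6⟩
  · rw [hm]
    obtain ⟨s, hs⟩ := secG
    haveI : Nonempty (Set.range (fun h : H => r • h) × {g : G | r • g = 0}) :=
      ⟨(⟨r • 0, 0, rfl⟩, ⟨0, smul_zero r⟩)⟩
    have := final h0 r (T := Set.range (fun h : H => r • h) × {g : G | r • g = 0})
      (fun b => (⟨r • f b, f b, rfl⟩, ⟨b - s (r • b), by
        simp [smul_sub, hs]⟩)) ?_ α hα hle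
    · rw [Nat.card_prod] at this
      push_cast at this
      exact this
    · intro a b a' b' h1 h2
      simp only [gam, Prod.smul_mk, Prod.mk_add_mk, Prod.mk.injEq, Subtype.mk.injEq] at h1 h2
      obtain ⟨h3, h4⟩ := h1
      obtain ⟨h5s, h6s⟩ := h2
      have h5 : r • f b = r • f b' := congrArg Subtype.val h5s
      have h6 : b - s (r • b) = b' - s (r • b') := h6s
      rw [h5, add_left_inj] at h4
      have := hf h4
      subst this
      rw [add_right_inj] at h3
      rw [h3, sub_left_inj] at h6
      exact ⟨rfl, h6⟩
end

section
/- There exists an absolute constant C such that for every odd prime p and every injection f : Z/pZ → (Z/2Z)^n, the probability over uniform independent x,y ∈ Z/pZ that f(x+y) = f(x)+f(y) is at most C · p^{−1/11}. -/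
theorem aux_ite (a b c d e : Prop) [Decidable a] [Decidable b] [Decidable c] [Decidable d]
    [Decidable e] [Decidable (a ∧ b ∧ c ∧ d ∧ e)] :
    (if a ∧ b ∧ c ∧ d ∧ e then (1 : ℝ) else 0) =
      (if a then 1 else 0) * (((if b then 1 else 0) * (if c then 1 else 0)) *
        ((if d then 1 else 0) * (if e then 1 else 0))) := by
  by_cases a <;> by_cases b <;> by_cases c <;> by_cases d <;> by_cases e <;> simp [*]

open Finset in
theorem aux_count {p n : ℕ} [Fact p.Prime] (hp2 : Odd p)
    (f : ZMod p → (Fin n → ZMod 2)) (hf : Function.Injective f)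
    (r : ZMod p → ZMod p → ℝ)
    (hr : ∀ v b, r v b = if f v = f b + f (v - b) then 1 else 0) :
    ∑ v, ∑ b, ∑ b', r v b * r v b' * (∑ a, r a b * r a b') * (∑ a, r a b * r a (v - b'))
      ≤ (p : ℝ) ^ 4 := by
  classical
  let S : Finset (ZMod p × ZMod p × ZMod p × ZMod p × ZMod p) :=
    univ.filter fun t => (f t.1 = f t.2.2.1 + f (t.1 - t.2.2.1)) ∧
      (f t.2.2.2.1 = f t.2.1 + f (t.2.2.2.1 - t.2.1)) ∧
      (f t.2.2.2.1 = f t.2.2.1 + f (t.2.2.2.1 - t.2.2.1)) ∧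
      (f t.2.2.2.2 = f t.2.1 + f (t.2.2.2.2 - t.2.1)) ∧
      (f t.2.2.2.2 = f (t.1 - t.2.2.1) + f (t.2.2.2.2 - (t.1 - t.2.2.1)))
  have hchar : ∀ x : Fin n → ZMod 2, x + x = 0 := fun x => by
    funext i; exact CharTwo.add_self_eq_zero (x i)
  have hsub : ∀ x y z : Fin n → ZMod 2, x = y + z → z = x + y := by
    intro x y z h
    rw [h]
    calc z = z + 0 := by simp
      _ = z + (y + y) := by rw [hchar]
      _ = _ := by abel
  have h2 : (2 : ZMod p) ≠ 0 := by
    intro h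
    have : (p : ℕ) ∣ 2 := (ZMod.natCast_eq_zero_iff 2 p).1 (by exact_mod_cast h)
    have h3 : p ≤ 2 := Nat.le_of_dvd (by norm_num) this
    have h4 := (Fact.out : p.Prime).two_le
    have : p = 2 := le_antisymm h3 h4
    subst this
    exact absurd hp2 (by decide)
  have hcard : S.card ≤ p ^ 4 := by
    have : S.card ≤ (univ : Finset (ZMod p × ZMod p × ZMod p × ZMod p)).card := by
      apply Finset.card_le_card_of_injOn
        (fun t => (t.2.2.2.1 - t.2.2.1, t.2.2.2.1 - t.2.1,
          t.2.2.2.2 - (t.1 - t.2.2.1), t.2.2.2.2 - t.2.1))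
      · intro t _; simp
      · have key : ∀ t ∈ S, f t.1 = f (t.2.2.2.1 - t.2.2.1) + f (t.2.2.2.1 - t.2.1) +
            f (t.2.2.2.2 - (t.1 - t.2.2.1)) + f (t.2.2.2.2 - t.2.1) := by
          intro t ht
          simp only [S, mem_filter, mem_univ, true_and] at ht
          obtain ⟨h0, h1, h2, h3, h4⟩ := ht
          rw [hsub _ _ _ h1, hsub _ _ _ h2, hsub _ _ _ h3, hsub _ _ _ h4]
          calc f t.1 = f t.2.2.1 + f (t.1 - t.2.2.1) := h0
            _ = f t.2.2.1 + f (t.1 - t.2.2.1) + (f t.2.2.2.1 + f t.2.2.2.1)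
              + (f t.2.2.2.2 + f t.2.2.2.2) + (f t.2.1 + f t.2.1) := by
                rw [hchar, hchar, hchar]; simp
            _ = _ := by abel
        intro s hs t ht hst
        have ks := key s hs
        have kt := key t ht
        simp only [Prod.mk.injEq] at hst
        obtain ⟨e1, e2, e3, e4⟩ := hst
        rw [e1, e2, e3, e4, ← kt] at ks
        have hv := hf ks
        obtain ⟨v, b, b', a, c⟩ := s
        obtain ⟨v1, b1, b1', a1, c1⟩ := t
        simp only at hv e1 e2 e3 e4
        subst hv
        have hb : b = b1 := by
          apply mul_left_cancel₀ h2
          linear_combination e1 - e2 + e3 - e4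
        subst hb
        have ha : a = a1 := by linear_combination e2
        have hc : c = c1 := by linear_combination e4
        subst ha hc
        have hb' : b' = b1' := by linear_combination -e1
        subst hb'
        rfl
    refine this.trans (le_of_eq ?_)
    simp [ZMod.card]; ring
  have hle : ∑ v, ∑ b, ∑ b', r v b * r v b' * (∑ a, r a b * r a b') *
      (∑ a, r a b * r a (v - b')) ≤ (S.card : ℝ) := by
    have : (S.card : ℝ) = ∑ v, ∑ b, ∑ b', r v b' * (∑ a, r a b * r a b') *
      (∑ a, r a b * r a (v - b')) := by
      rw [Finset.card_filter]
      push_cast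
      simp only [Fintype.sum_prod_type]
      refine sum_congr rfl fun v _ => sum_congr rfl fun b _ => sum_congr rfl fun b' _ => ?_
      rw [mul_assoc, Finset.sum_mul_sum, Finset.mul_sum]
      refine sum_congr rfl fun a _ => ?_
      rw [Finset.mul_sum]
      refine sum_congr rfl fun c _ => ?_
      simp only [hr]
      exact aux_ite _ _ _ _ _
    rw [this]
    have hr0 : ∀ v b, 0 ≤ r v b := fun v b => by rw [hr]; split_ifs <;> norm_num
    have hr1 : ∀ v b, r v b ≤ 1 := fun v b => by rw [hr]; split_ifs <;> norm_num
    refine sum_le_sum fun v _ => sum_le_sum fun b _ => sum_le_sum fun b' _ => ?_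
    have w1 : 0 ≤ ∑ a, r a b * r a b' := sum_nonneg fun a _ => mul_nonneg (hr0 _ _) (hr0 _ _)
    have w2 : 0 ≤ ∑ a, r a b * r a (v - b') :=
      sum_nonneg fun a _ => mul_nonneg (hr0 _ _) (hr0 _ _)
    have := mul_le_of_le_one_left (mul_nonneg (mul_nonneg (hr0 v b') w1) w2) (hr1 v b)
    calc _ = _ := by ring
      _ ≤ _ := this
  exact hle.trans (by exact_mod_cast hcard)

open Finset in
theorem aux_lower_s5 {p : ℕ} [Fact p.Prime] (r : ZMod p → ZMod p → ℝ)
    (hr0 : ∀ v b, 0 ≤ r v b) (hsym : ∀ v b, r v (v - b) = r v b) (E : ℝ)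
    (hE : E = ∑ v, ∑ b, r v b) :
    E ^ 6 ≤ 32 * (p : ℝ) ^ 7 *
     ∑ v, ∑ b, ∑ b', r v b * r v b' * (∑ a, r a b * r a b') * (∑ a, r a b * r a (v - b')) := by
  classical
  have hp : (0 : ℝ) < p := by exact_mod_cast (Fact.out : p.Prime).pos
  set w : ZMod p → ZMod p → ℝ := fun b b' => ∑ a, r a b * r a b' with hw
  have hw0 : ∀ b b', 0 ≤ w b b' := fun b b' =>
    sum_nonneg fun a _ => mul_nonneg (hr0 _ _) (hr0 _ _)
  set τ : ℝ := E ^ 2 / (4 * p ^ 3) with hτ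
  have hτ0 : 0 ≤ τ := by positivity
  let k : ZMod p → ZMod p → ℝ := fun b b' => if w b b' < τ then 1 else 0
  have hpt : ∀ x y : ℝ, 0 ≤ x → 0 ≤ y →
      τ ^ 2 * (1 - (if x < τ then 1 else 0) - (if y < τ then 1 else 0)) ≤ x * y := by
    intro x y hx hy
    split_ifs with h1 h2 h2
    · nlinarith [mul_nonneg hx hy]
    · nlinarith [mul_nonneg hx hy]
    · nlinarith [mul_nonneg hx hy]
    · push Not at h1 h2
      nlinarith [mul_le_mul h1 h2 hτ0 hx]
  have hmain : τ ^ 2 * ∑ v, ∑ b, ∑ b', r v b * r v b' * (1 - k b b' - k b (v - b')) ≤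
      ∑ v, ∑ b, ∑ b', r v b * r v b' * w b b' * w b (v - b') := by
    simp only [mul_sum]
    refine sum_le_sum fun v _ => sum_le_sum fun b _ => sum_le_sum fun b' _ => ?_
    have := mul_le_mul_of_nonneg_left (hpt (w b b') (w b (v - b')) (hw0 _ _) (hw0 _ _))
      (mul_nonneg (hr0 v b) (hr0 v b'))
    calc _ = _ := by ring
      _ ≤ _ := this
      _ = _ := by ring
  have hbad : ∑ v, ∑ b, ∑ b', r v b * r v b' * k b b' ≤ τ * p ^ 2 := by
    calc _ = ∑ b, ∑ b', w b b' * k b b' := by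
          rw [sum_comm]
          refine sum_congr rfl fun b _ => ?_
          rw [sum_comm]
          refine sum_congr rfl fun b' _ => ?_
          rw [hw, sum_mul]
      _ ≤ ∑ b : ZMod p, ∑ b' : ZMod p, τ := by
          refine sum_le_sum fun b _ => sum_le_sum fun b' _ => ?_
          simp only [k]
          split_ifs with h
          · linarith
          · simpa using hτ0
      _ = _ := by simp [ZMod.card]; ring
  have hbad2 : ∑ v, ∑ b, ∑ b', r v b * r v b' * k b (v - b') =
      ∑ v, ∑ b, ∑ b', r v b * r v b' * k b b' := by
    refine sum_congr rfl fun v _ => sum_congr rfl fun b _ => ?_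
    refine Fintype.sum_equiv (Equiv.subLeft v) _ _ fun b' => ?_
    simp [hsym]
  have hCS : E ^ 2 ≤ p * ∑ v, ∑ b, ∑ b', r v b * r v b' := by
    have := sq_sum_le_card_mul_sum_sq (s := (univ : Finset (ZMod p))) (f := fun v => ∑ b, r v b)
    rw [← hE, card_univ, ZMod.card] at this
    refine this.trans (le_of_eq ?_)
    congr 1
    refine sum_congr rfl fun v _ => ?_
    rw [sq, sum_mul_sum]
  have hsplit : ∑ v, ∑ b, ∑ b', r v b * r v b' * (1 - k b b' - k b (v - b')) =
      ∑ v, ∑ b, ∑ b', r v b * r v b' - ∑ v, ∑ b, ∑ b', r v b * r v b' * k b b'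
        - ∑ v, ∑ b, ∑ b', r v b * r v b' * k b (v - b') := by
    simp only [← sum_sub_distrib]
    refine sum_congr rfl fun v _ => sum_congr rfl fun b _ => sum_congr rfl fun b' _ => ?_
    ring
  rw [hsplit, hbad2] at hmain
  have h1 : E ^ 2 / (2 * p) ≤ ∑ v, ∑ b, ∑ b', r v b * r v b' -
      ∑ v, ∑ b, ∑ b', r v b * r v b' * k b b' - ∑ v, ∑ b, ∑ b', r v b * r v b' * k b b' := by
    have h2 : E ^ 2 / p ≤ ∑ v, ∑ b, ∑ b', r v b * r v b' := by
      rw [div_le_iff₀ hp]; linarith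
    have h3 : τ * p ^ 2 = E ^ 2 / (4 * p) := by rw [hτ]; field_simp
    have h4 : E ^ 2 / (2 * p) = E ^ 2 / p - 2 * (E ^ 2 / (4 * p)) := by field_simp; ring
    linarith
  have h5 := (mul_le_mul_of_nonneg_left h1 (sq_nonneg τ)).trans hmain
  calc E ^ 6 = 32 * (p : ℝ) ^ 7 * (τ ^ 2 * (E ^ 2 / (2 * p))) := by rw [hτ]; field_simp; ring
    _ ≤ _ := mul_le_mul_of_nonneg_left h5 (by positivity)

open Finset in
theorem stmt_5 :
    ∃ C : ℝ, 0 < C ∧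
      ∀ (p n : ℕ), p.Prime → Odd p →
        ∀ f : ZMod p → (Fin n → ZMod 2), Function.Injective f →
          (Nat.card {xy : ZMod p × ZMod p // f (xy.1 + xy.2) = f xy.1 + f xy.2} : ℝ) / (p : ℝ) ^ 2
            ≤ C * (p : ℝ) ^ (-(1 : ℝ) / 11) := by
  refine ⟨2, by norm_num, ?_⟩
  intro p n hp hodd f hf
  classical
  have : Fact p.Prime := ⟨hp⟩
  have hp0 : (0 : ℝ) < p := by exact_mod_cast hp.pos
  have hp1 : (1 : ℝ) ≤ p := by exact_mod_cast hp.one_le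
  let r : ZMod p → ZMod p → ℝ := fun v b => if f v = f b + f (v - b) then 1 else 0
  have hE : (Nat.card {xy : ZMod p × ZMod p // f (xy.1 + xy.2) = f xy.1 + f xy.2} : ℝ) =
      ∑ v, ∑ b, r v b := by
    rw [Nat.card_eq_fintype_card, Fintype.card_subtype, card_filter]
    push_cast
    rw [Fintype.sum_prod_type, sum_comm (f := r)]
    refine sum_congr rfl fun x _ => ?_
    refine Fintype.sum_equiv (Equiv.addLeft x) _ _ fun y => ?_
    simp [r]
  have hr0 : ∀ v b, 0 ≤ r v b := fun v b => by simp only [r]; split_ifs <;> norm_num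
  have hsym : ∀ v b, r v (v - b) = r v b := fun v b => by simp [r, add_comm]
  have h1 := aux_count hodd f hf r (fun _ _ => rfl)
  have h2 := aux_lower_s5 r hr0 hsym _ hE
  set E : ℝ := (Nat.card {xy : ZMod p × ZMod p // f (xy.1 + xy.2) = f xy.1 + f xy.2} : ℝ)
  have h3 : E ^ 6 ≤ 32 * (p : ℝ) ^ 7 * (p : ℝ) ^ 4 :=
    h2.trans (mul_le_mul_of_nonneg_left h1 (by positivity))
  have hmono : (p : ℝ) ^ (-(1 : ℝ) / 6) ≤ (p : ℝ) ^ (-(1 : ℝ) / 11) :=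
    Real.rpow_le_rpow_of_exponent_le hp1 (by norm_num)
  have h6 : ((p : ℝ) ^ (-(1 : ℝ) / 6)) ^ 6 = (p : ℝ)⁻¹ := by
    rw [← Real.rpow_natCast, ← Real.rpow_mul hp0.le, ← Real.rpow_neg_one]
    norm_num
  have hfin : E / (p : ℝ) ^ 2 ≤ 2 * (p : ℝ) ^ (-(1 : ℝ) / 6) := by
    refine le_of_pow_le_pow_left₀ (n := 6) (by norm_num) (by positivity) ?_
    rw [mul_pow, h6, div_pow, div_le_iff₀ (by positivity)]
    refine h3.trans ?_
    have : (2 : ℝ) ^ 6 * (p : ℝ)⁻¹ * ((p : ℝ) ^ 2) ^ 6 = 64 * (p : ℝ) ^ 11 := by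
      field_simp; norm_num
    rw [this]
    nlinarith [pow_pos hp0 11]
  linarith
end

section
/- There exists an absolute constant C such that for every n and every injection f : (Z/2Z)^{2n} → (Z/4Z)^n, the probability over uniform independent x,y ∈ (Z/2Z)^{2n} that f(x+y) = f(x)+f(y) is at most C · 2^{−n/11}. -/
open Finset

/-- Lower bound for the number of weighted 5-cycles. -/
lemma cfg_lower {G : Type*} [AddCommGroup G] [Fintype G] (g : G → G → ℝ)
    (g0 : ∀ x y, 0 ≤ g x y) (N W : ℝ) (hN : N = Fintype.card G)
    (c c' : G → G → ℝ)
    (hc : ∀ u y, c u y = ∑ x, g x y * g x u)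
    (hc' : ∀ u z, c' u z = ∑ x, g x (x + z) * g x u)
    (hinv : ∀ x : G, x + x = 0)
    (hW : W = ∑ u, ∑ y, ∑ x, g x y * g x u) :
    W ^ 3 ≤ 27 * N ^ 4 * ∑ u, ∑ y, ∑ x, g x y * g x u * (c u y * c' u (x + y)) := by
  have hNpos : 0 < N := by
    rw [hN]; exact_mod_cast Fintype.card_pos
  have hW0 : 0 ≤ W := by
    rw [hW]
    exact sum_nonneg fun u _ => sum_nonneg fun y _ => sum_nonneg fun x _ =>
      mul_nonneg (g0 _ _) (g0 _ _)
  set t : ℝ := W / (3 * N ^ 2) with ht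
  have ht0 : 0 ≤ t := by positivity
  have c0 : ∀ u y, 0 ≤ c u y := fun u y => by
    rw [hc]; exact sum_nonneg fun x _ => mul_nonneg (g0 _ _) (g0 _ _)
  have c0' : ∀ u y, 0 ≤ c' u y := fun u y => by
    rw [hc']; exact sum_nonneg fun x _ => mul_nonneg (g0 _ _) (g0 _ _)
  let e : ℝ → ℝ := fun r => if r < t then 1 else 0
  have he : ∀ r, r * e r ≤ t := by
    intro r
    by_cases h : r < t
    · simp [e, h, h.le]
    · simp [e, h, ht0]
  have key : ∀ a b : ℝ, 0 ≤ a → 0 ≤ b → t ^ 2 * (1 - e a - e b) ≤ a * b := by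
    intro a b ha hb
    have hab := mul_nonneg ha hb
    by_cases h : a < t <;> by_cases h' : b < t <;> simp only [e, h, h', if_true, if_false]
    · nlinarith [sq_nonneg t]
    · nlinarith
    · nlinarith
    · push Not at h h'
      nlinarith [mul_le_mul h h' ht0 ha]
  have b1 : ∑ u, ∑ y, ∑ x, g x y * g x u * e (c u y) ≤ N ^ 2 * t := by
    have : ∀ u y, ∑ x, g x y * g x u * e (c u y) ≤ t := by
      intro u y
      rw [← sum_mul, ← hc]; exact he _
    calc _ ≤ ∑ u : G, ∑ y : G, t := sum_le_sum fun u _ => sum_le_sum fun y _ => this u y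
      _ = N ^ 2 * t := by simp [hN]; ring
  have b2 : ∑ u, ∑ y, ∑ x, g x y * g x u * e (c' u (x + y)) ≤ N ^ 2 * t := by
    have : ∀ u z, ∑ x, g x (x + z) * g x u * e (c' u z) ≤ t := by
      intro u y
      rw [← sum_mul, ← hc']; exact he _
    calc _ = ∑ u : G, ∑ z : G, ∑ x, g x (x + z) * g x u * e (c' u z) := by
            refine sum_congr rfl fun u _ => ?_
            rw [sum_comm, sum_comm (s := univ (α := G)) (t := univ (α := G))
              (f := fun z x => g x (x + z) * g x u * e (c' u z))]
            refine sum_congr rfl fun x _ => ?_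
            refine Fintype.sum_equiv (Equiv.addLeft x) _ _ fun y => ?_
            simp [← add_assoc, hinv]
      _ ≤ ∑ u : G, ∑ y : G, t := sum_le_sum fun u _ => sum_le_sum fun y _ => this u y
      _ = N ^ 2 * t := by simp [hN]; ring
  have main : t ^ 2 * (W - ∑ u, ∑ y, ∑ x, g x y * g x u * e (c u y)
        - ∑ u, ∑ y, ∑ x, g x y * g x u * e (c' u (x + y)))
      ≤ ∑ u, ∑ y, ∑ x, g x y * g x u * (c u y * c' u (x + y)) := by
    rw [hW]
    simp only [← sum_sub_distrib, mul_sum]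
    refine sum_le_sum fun u _ => sum_le_sum fun y _ => sum_le_sum fun x _ => ?_
    have := mul_le_mul_of_nonneg_left (key (c u y) (c' u (x + y)) (c0 _ _) (c0' _ _))
      (mul_nonneg (g0 x y) (g0 x u))
    linarith
  have h3 : t ^ 2 * (W - 2 * (N ^ 2 * t))
      ≤ ∑ u, ∑ y, ∑ x, g x y * g x u * (c u y * c' u (x + y)) :=
    le_trans (mul_le_mul_of_nonneg_left (by linarith) (sq_nonneg t)) main
  have h4 : 27 * N ^ 4 * (t ^ 2 * (W - 2 * (N ^ 2 * t))) = W ^ 3 := by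
    rw [ht]; field_simp; ring
  rw [← h4]
  exact mul_le_mul_of_nonneg_left h3 (by positivity)

lemma two_tors (n : ℕ) (k : Fin n → ZMod 4) :
    (univ.filter fun h : Fin n → ZMod 4 => h + h = k).card ≤ 2 ^ n := by
  have h1 : (univ.filter fun h : Fin n → ZMod 4 => h + h = k)
      ⊆ Fintype.piFinset fun i => univ.filter fun a : ZMod 4 => a + a = k i := by
    intro h hh
    simp only [mem_filter, mem_univ, true_and] at hh
    simp [Fintype.mem_piFinset, ← hh]
  refine (card_le_card h1).trans ?_
  rw [Fintype.card_piFinset]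
  have : ∀ b : ZMod 4, (univ.filter fun a : ZMod 4 => a + a = b).card ≤ 2 := by decide
  calc _ ≤ ∏ _i : Fin n, 2 := prod_le_prod' fun i _ => this _
    _ = 2 ^ n := by simp

/-- Upper bound for the number of configurations. -/
lemma cfg_upper {G H : Type*} [AddCommGroup G] [Fintype G] [DecidableEq G]
    [AddCommGroup H] [DecidableEq H] [Fintype H]
    (f : G → H) (hf : Function.Injective f) (R : ℕ)
    (hR : ∀ k : H, (univ.filter fun h : H => h + h = k).card ≤ R)
    (hinv : ∀ x : G, x + x = 0) :
    (univ.filter fun q : G × G × G × G × G =>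
      (f (q.2.2.1 + q.2.1) = f q.2.2.1 + f q.2.1) ∧
      (f (q.2.2.2.1 + q.2.1) = f q.2.2.2.1 + f q.2.1) ∧
      (f (q.2.2.2.1 + q.1) = f q.2.2.2.1 + f q.1) ∧
      (f (q.2.2.2.2 + (q.2.2.2.2 + (q.2.2.1 + q.2.1)))
        = f q.2.2.2.2 + f (q.2.2.2.2 + (q.2.2.1 + q.2.1))) ∧
      (f (q.2.2.2.2 + q.1) = f q.2.2.2.2 + f q.1)).card
      ≤ Fintype.card G ^ 4 * R := by
  have hU : ∀ k : H, (univ.filter fun u : G => f u + f u = k).card ≤ R := by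
    intro k
    refine le_trans ?_ (hR k)
    refine card_le_card_of_injOn f ?_ hf.injOn
    intro u hu
    simpa using hu
  let Φ : G × G × G × G → H := fun a =>
    f a.2.2.1 + f a.2.2.2 - f (a.1 + a.2.1 + a.2.2.1 + a.2.2.2) - f a.1 + f a.2.1
  let T : Finset (Σ _ : G × G × G × G, G) :=
    univ.sigma fun a => univ.filter fun u : G => f u + f u = Φ a
  have hT : T.card ≤ Fintype.card G ^ 4 * R := by
    rw [card_sigma]
    calc _ ≤ ∑ _a : G × G × G × G, R := sum_le_sum fun a _ => hU _
      _ = _ := by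
        rw [sum_const, card_univ, smul_eq_mul]; simp only [Fintype.card_prod]; ring
  refine le_trans ?_ hT
  have cancel : ∀ a b : G, a + (a + b) = b := fun a b => by rw [← add_assoc, hinv, zero_add]
  refine card_le_card_of_injOn (fun q => ⟨(q.2.2.2.1 + q.2.1, q.2.2.2.1 + q.1, q.2.2.2.2 + q.1,
    q.2.2.2.2 + (q.2.2.1 + q.2.1)), q.1⟩) ?_ ?_
  · rintro ⟨u, y, x, x1, x3⟩ hq
    simp only [coe_filter, mem_univ, true_and, Set.mem_setOf_eq] at hq
    obtain ⟨h1, h2, h3, h4, h5⟩ := hq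
    simp only [T, coe_sigma, Set.mem_sigma_iff, coe_univ, Set.mem_univ, true_and, coe_filter,
      mem_univ, Set.mem_setOf_eq, Φ]
    have e5 : x1 + y + (x1 + u) + (x3 + u) + (x3 + (x + y)) = x := by
      have : x1 + y + (x1 + u) + (x3 + u) + (x3 + (x + y))
        = (x1 + x1) + (y + y) + (u + u) + (x3 + x3) + x := by abel
      rw [this]; simp [hinv]
    rw [e5]
    rw [cancel, h1] at h4
    rw [h5, h2, h3]
    have h6 : f (x3 + (x + y)) = f x + f y - f x3 := by rw [h4]; abel
    rw [h6]; abel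
  · rintro ⟨u, y, x, x1, x3⟩ _ ⟨u', y', x', x1', x3'⟩ _ hq
    simp only [Sigma.mk.injEq, Prod.mk.injEq, heq_eq_eq] at hq
    obtain ⟨⟨h1, h2, h3, h4⟩, rfl⟩ := hq
    obtain rfl := add_right_cancel h2
    obtain rfl := add_right_cancel h3
    obtain rfl := add_left_cancel h1
    obtain rfl := add_right_cancel (add_left_cancel h4)
    rfl

lemma ite_aux (a a' b c d e : Prop) [Decidable a] [Decidable a'] [Decidable b] [Decidable c]
    [Decidable d] [Decidable e] :
    (if a then (1 : ℝ) else 0) * (if a' then (1 : ℝ) else 0) *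
      ((if b then (1 : ℝ) else 0) * (if c then (1 : ℝ) else 0) *
        ((if d then (1 : ℝ) else 0) * (if e then (1 : ℝ) else 0)))
      ≤ if a ∧ b ∧ c ∧ d ∧ e then (1 : ℝ) else 0 := by
  by_cases a <;> by_cases a' <;> by_cases b <;> by_cases c <;> by_cases d <;> by_cases e <;>
    simp [*]

lemma main_bound {G H : Type*} [AddCommGroup G] [Fintype G] [DecidableEq G]
    [AddCommGroup H] [DecidableEq H] [Fintype H]
    (f : G → H) (hf : Function.Injective f) (R : ℕ)
    (hR : ∀ k : H, (univ.filter fun h : H => h + h = k).card ≤ R)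
    (hinv : ∀ x : G, x + x = 0) :
    ((univ.filter fun q : G × G => f (q.1 + q.2) = f q.1 + f q.2).card : ℝ) ^ 6
      ≤ 27 * (Fintype.card G : ℝ) ^ 11 * R := by
  set N : ℝ := (Fintype.card G : ℝ) with hN
  let g : G → G → ℝ := fun x y => if f (x + y) = f x + f y then 1 else 0
  have g0 : ∀ x y, 0 ≤ g x y := fun x y => by simp only [g]; split_ifs <;> norm_num
  have low := cfg_lower g g0 N _ hN (fun u y => ∑ x, g x y * g x u)
    (fun u z => ∑ x, g x (x + z) * g x u) (fun _ _ => rfl) (fun _ _ => rfl) hinv rfl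
  have up := cfg_upper f hf R hR hinv
  set M : ℝ := ((univ.filter fun q : G × G => f (q.1 + q.2) = f q.1 + f q.2).card : ℝ) with hM
  have hM1 : M = ∑ x, ∑ y, g x y := by
    rw [hM, card_filter]; push_cast; rw [Fintype.sum_prod_type]
  have hM0 : 0 ≤ M := by positivity
  have hcs : M ^ 2 ≤ N * ∑ u, ∑ y, ∑ x, g x y * g x u := by
    have e : ∑ u, ∑ y, ∑ x, g x y * g x u = ∑ x, (∑ y, g x y) ^ 2 := by
      have : ∀ u, ∑ y, ∑ x, g x y * g x u = ∑ x, (∑ y, g x y) * g x u := by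
        intro u; rw [sum_comm]; simp only [sum_mul]
      simp only [this]
      rw [sum_comm]
      refine sum_congr rfl fun x _ => ?_
      rw [← mul_sum, sq]
    rw [e, hM1, hN]
    have := sq_sum_le_card_mul_sum_sq (s := (univ : Finset G)) (f := fun x => ∑ y, g x y)
    simpa using this
  have hcfg : ∑ u, ∑ y, ∑ x, g x y * g x u * ((∑ x1, g x1 y * g x1 u) *
      (∑ x3, g x3 (x3 + (x + y)) * g x3 u)) ≤ N ^ 4 * R := by
    have up' : ((_ : ℕ) : ℝ) ≤ ((_ : ℕ) : ℝ) := Nat.cast_le.mpr up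
    rw [card_filter] at up'
    push_cast at up'
    simp only [Fintype.sum_prod_type] at up'
    refine le_trans ?_ up'
    refine sum_le_sum fun u _ => sum_le_sum fun y _ => sum_le_sum fun x _ => ?_
    rw [sum_mul_sum, mul_sum]
    refine sum_le_sum fun x1 _ => ?_
    rw [mul_sum]
    refine sum_le_sum fun x3 _ => ?_
    exact ite_aux _ _ _ _ _ _
  have hN0 : 0 ≤ N := by positivity
  set W := ∑ u, ∑ y, ∑ x, g x y * g x u with hW
  calc M ^ 6 = (M ^ 2) ^ 3 := by ring
    _ ≤ (N * W) ^ 3 := pow_le_pow_left₀ (by positivity) hcs 3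
    _ = N ^ 3 * W ^ 3 := by ring
    _ ≤ N ^ 3 * (27 * N ^ 4 * (N ^ 4 * R)) := by
        refine mul_le_mul_of_nonneg_left (low.trans ?_) (by positivity)
        exact mul_le_mul_of_nonneg_left hcfg (by positivity)
    _ = _ := by ring

theorem stmt_6 :
    ∃ C : ℝ, 0 < C ∧
      ∀ (n : ℕ) (f : (Fin (2 * n) → ZMod 2) → (Fin n → ZMod 4)), Function.Injective f →
        (Nat.card {xy : (Fin (2 * n) → ZMod 2) × (Fin (2 * n) → ZMod 2) //
            f (xy.1 + xy.2) = f xy.1 + f xy.2} : ℝ) / ((4 : ℝ) ^ n * 4 ^ n)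
          ≤ C * (2 : ℝ) ^ (-(n : ℝ) / 11) := by
  refine ⟨2, by norm_num, fun n f hf => ?_⟩
  have h := main_bound f hf (2 ^ n) (two_tors n) (fun x => by
    ext i; exact CharTwo.add_self_eq_zero _)
  rw [Nat.card_eq_fintype_card, Fintype.card_subtype]
  set M : ℝ := ((univ.filter fun q : (Fin (2 * n) → ZMod 2) × (Fin (2 * n) → ZMod 2) =>
    f (q.1 + q.2) = f q.1 + f q.2).card : ℝ) with hM
  have hcard : (Fintype.card (Fin (2 * n) → ZMod 2) : ℝ) = 4 ^ n := by
    simp only [Fintype.card_fun, ZMod.card, Fintype.card_fin, pow_mul]; norm_num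
  rw [hcard] at h
  push_cast at h
  have h4 : (4 : ℝ) ^ n = 2 ^ n * 2 ^ n := by rw [← mul_pow]; norm_num
  have hp : (0 : ℝ) < 2 ^ n := by positivity
  have hr : (0 : ℝ) < (2 : ℝ) ^ (-(n : ℝ) / 11) := by positivity
  refine le_of_pow_le_pow_left₀ (n := 6) (by norm_num) (by positivity) ?_
  have h6 : ((2 : ℝ) ^ n)⁻¹ ≤ ((2 : ℝ) ^ (-(n : ℝ) / 11)) ^ 6 := by
    rw [← Real.rpow_natCast, ← Real.rpow_natCast, ← Real.rpow_mul (by norm_num),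
      ← Real.rpow_neg (by norm_num)]
    refine Real.rpow_le_rpow_of_exponent_le (by norm_num) ?_
    have : (0 : ℝ) ≤ n := by positivity
    push_cast
    linarith
  rw [div_pow, mul_pow (2 : ℝ)]
  calc M ^ 6 / ((4 : ℝ) ^ n * 4 ^ n) ^ 6
      ≤ (27 * ((4 : ℝ) ^ n) ^ 11 * 2 ^ n) / ((4 : ℝ) ^ n * 4 ^ n) ^ 6 := by gcongr
    _ = 27 * ((2 : ℝ) ^ n)⁻¹ := by rw [h4]; field_simp
    _ ≤ 2 ^ 6 * ((2 : ℝ) ^ (-(n : ℝ) / 11)) ^ 6 := by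
        have : 0 < ((2 : ℝ) ^ n)⁻¹ := by positivity
        nlinarith
end

section
/- Let G and H be Abelian groups with G finite, let Γ ⊆ G × H be a finite set such that both coordinate projections restricted to Γ are injective, and let r ∈ N. Then there is an absolute constant C such that (1/|Γ|²)⟨1_Γ ∗ 1_Γ, 1_Γ⟩ ≤ (C|r·G||K_{H,r}|/|Γ|)^α for any α ≤ max{1/(5r+1), 1/(18⌊log₂ r⌋ + 7)}. -/
open scoped Classical in
/-- size of the fibre of `Z` through `ω` -/
noncomputable def fib {Ω S : Type*} [Fintype Ω] (Z : Ω → S) (ω : Ω) : ℝ :=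
  ∑ ω' : Ω, if Z ω' = Z ω then (1 : ℝ) else 0

/-- Shannon entropy of `Z` under the uniform measure on `Ω` -/
noncomputable def ent {Ω S : Type*} [Fintype Ω] (Z : Ω → S) : ℝ :=
  Real.log (Fintype.card Ω) - (∑ ω : Ω, Real.log (fib Z ω)) / (Fintype.card Ω)

open scoped Classical in
theorem fib_ge_one {Ω S : Type*} [Fintype Ω] (Z : Ω → S) (ω : Ω) : 1 ≤ fib Z ω := by
  unfold fib
  have := Finset.single_le_sum (f := fun ω' : Ω => if Z ω' = Z ω then (1 : ℝ) else 0)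
    (fun i _ => by positivity) (Finset.mem_univ ω)
  simpa using this

theorem fib_pos {Ω S : Type*} [Fintype Ω] (Z : Ω → S) (ω : Ω) : 0 < fib Z ω :=
  lt_of_lt_of_le one_pos (fib_ge_one Z ω)

theorem fib_congr {Ω S : Type*} [Fintype Ω] (Z : Ω → S) {ω ω' : Ω} (h : Z ω = Z ω') :
    fib Z ω = fib Z ω' := by
  unfold fib; rw [h]

open scoped Classical in
theorem sum_inv_fib {Ω S : Type*} [Fintype Ω] (Z : Ω → S) (t : S) :
    ∑ ω : Ω, (if Z ω = t then (fib Z ω)⁻¹ else 0) ≤ 1 := by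
  by_cases h : ∃ ω₀, Z ω₀ = t
  · obtain ⟨ω₀, rfl⟩ := h
    have : ∑ ω : Ω, (if Z ω = Z ω₀ then (fib Z ω)⁻¹ else 0)
        = (∑ ω : Ω, if Z ω = Z ω₀ then (1 : ℝ) else 0) * (fib Z ω₀)⁻¹ := by
      rw [Finset.sum_mul]
      refine Finset.sum_congr rfl fun ω _ => ?_
      split_ifs with h
      · rw [fib_congr Z h]; simp
      · simp
    rw [this]
    have h2 : (∑ ω : Ω, if Z ω = Z ω₀ then (1 : ℝ) else 0) = fib Z ω₀ := rfl
    rw [h2, mul_inv_cancel₀ (fib_pos Z ω₀).ne']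
  · push Not at h
    simp [h]

theorem ent_gibbs {Ω S : Type*} [Fintype Ω] [Nonempty Ω] (Z : Ω → S) (T : Finset S)
    (hT : ∀ ω, Z ω ∈ T) (q : S → ℝ) (hq0 : ∀ s, 0 ≤ q s) (hq : ∀ ω, 0 < q (Z ω)) (Q : ℝ)
    (hQ0 : 0 < Q) (hQ : ∑ t ∈ T, q t ≤ Q) :
    ent Z ≤ Real.log Q - (∑ ω : Ω, Real.log (q (Z ω))) / (Fintype.card Ω) := by
  classical
  have hc : (0 : ℝ) < Fintype.card Ω := by exact_mod_cast Fintype.card_pos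
  have key : ∑ ω : Ω, q (Z ω) * (fib Z ω)⁻¹ ≤ Q := by
    calc ∑ ω : Ω, q (Z ω) * (fib Z ω)⁻¹
        = ∑ ω : Ω, ∑ t ∈ T, q t * (if Z ω = t then (fib Z ω)⁻¹ else 0) := by
          refine Finset.sum_congr rfl fun ω _ => ?_
          simp [hT ω]
      _ = ∑ t ∈ T, q t * ∑ ω : Ω, (if Z ω = t then (fib Z ω)⁻¹ else 0) := by
          rw [Finset.sum_comm]; simp_rw [Finset.mul_sum]
      _ ≤ ∑ t ∈ T, q t * 1 := by
          gcongr with t ht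
          · exact hq0 t
          · exact sum_inv_fib Z t
      _ ≤ Q := by simpa using hQ
  have h1 : ∀ ω : Ω, Real.log (Fintype.card Ω) - Real.log (fib Z ω) + Real.log (q (Z ω))
      - Real.log Q ≤ (Fintype.card Ω) / Q * (q (Z ω) * (fib Z ω)⁻¹) - 1 := by
    intro ω
    have hf := fib_pos Z ω
    have hqq := hq ω
    have := Real.log_le_sub_one_of_pos (x := (Fintype.card Ω) / Q * (q (Z ω) * (fib Z ω)⁻¹))
      (by positivity)
    rw [Real.log_mul (by positivity) (by positivity), Real.log_div (by positivity) (by positivity),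
      Real.log_mul (by positivity) (by positivity), Real.log_inv] at this
    linarith
  have h2 := Finset.sum_le_sum (s := Finset.univ) fun ω _ => h1 ω
  simp only [Finset.sum_sub_distrib, Finset.sum_add_distrib, ← Finset.mul_sum, Finset.sum_const,
    Finset.card_univ, nsmul_eq_mul, mul_one] at h2
  have h3 : (Fintype.card Ω) / Q * (∑ ω : Ω, q (Z ω) * (fib Z ω)⁻¹) ≤ Fintype.card Ω := by
    calc _ ≤ (Fintype.card Ω) / Q * Q := by gcongr
      _ = _ := by field_simp
  unfold ent
  rw [← mul_le_mul_iff_of_pos_left hc, mul_sub, mul_sub, mul_div_cancel₀ _ hc.ne',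
    mul_div_cancel₀ _ hc.ne']
  linarith

theorem ent_le_log {Ω S : Type*} [Fintype Ω] [Nonempty Ω] (Z : Ω → S) (T : Finset S)
    (hT : ∀ ω, Z ω ∈ T) : ent Z ≤ Real.log (T.card) := by
  have hpos : 0 < T.card := Finset.card_pos.2 ⟨_, hT (Classical.arbitrary Ω)⟩
  have := ent_gibbs Z T hT (fun _ => 1) (by simp) (by simp) T.card (by exact_mod_cast hpos)
    (by simp)
  simpa using this

open scoped Classical in
theorem ent_submod {Ω S₁ S₂ S₃ : Type*} [Fintype Ω] [Nonempty Ω] (Z₁ : Ω → S₁) (Z₂ : Ω → S₂)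
    (W : Ω → S₃) (h1 : ∀ ω ω', Z₁ ω = Z₁ ω' → W ω = W ω')
    (h2 : ∀ ω ω', Z₂ ω = Z₂ ω' → W ω = W ω') :
    ent (fun ω => (Z₁ ω, Z₂ ω)) + ent W ≤ ent Z₁ + ent Z₂ := by
  have hc : (0 : ℝ) < Fintype.card Ω := by exact_mod_cast Fintype.card_pos
  set J : Ω → S₁ × S₂ := fun ω => (Z₁ ω, Z₂ ω) with hJ
  have key : ∑ ω : Ω, fib Z₁ ω * fib Z₂ ω * ((fib W ω)⁻¹ * (fib J ω)⁻¹) ≤ Fintype.card Ω := by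
    calc ∑ ω : Ω, fib Z₁ ω * fib Z₂ ω * ((fib W ω)⁻¹ * (fib J ω)⁻¹)
        = ∑ ω : Ω, ∑ a : Ω, ∑ b : Ω, (if Z₁ a = Z₁ ω then (1 : ℝ) else 0) *
            (if Z₂ b = Z₂ ω then (1 : ℝ) else 0) * ((fib W ω)⁻¹ * (fib J ω)⁻¹) := by
          refine Finset.sum_congr rfl fun ω _ => ?_
          have e1 : fib Z₁ ω = ∑ a : Ω, if Z₁ a = Z₁ ω then (1 : ℝ) else 0 := rfl
          have e2 : fib Z₂ ω = ∑ a : Ω, if Z₂ a = Z₂ ω then (1 : ℝ) else 0 := rfl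
          rw [e1, e2, Finset.sum_mul_sum, Finset.sum_mul]
          simp_rw [Finset.sum_mul]
      _ ≤ ∑ ω : Ω, ∑ a : Ω, ∑ b : Ω, (if W b = W a then (1 : ℝ) else 0) * (fib W a)⁻¹ *
            (if J ω = (Z₁ a, Z₂ b) then (fib J ω)⁻¹ else 0) := by
          refine Finset.sum_le_sum fun ω _ => Finset.sum_le_sum fun a _ =>
            Finset.sum_le_sum fun b _ => ?_
          have hf := fib_pos W a
          have hg := fib_pos J ω
          by_cases ha : Z₁ a = Z₁ ω
          · by_cases hb : Z₂ b = Z₂ ω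
            · have hwa := h1 _ _ ha
              have hwb := h2 _ _ hb
              rw [fib_congr W hwa.symm, if_pos ha, if_pos hb, if_pos (hwb.trans hwa.symm),
                if_pos (by simp [hJ, ha, hb])]
              simp
            · rw [if_neg hb]; simp only [mul_zero, zero_mul]; positivity
          · rw [if_neg ha]; simp only [zero_mul]; positivity
      _ = ∑ a : Ω, ∑ b : Ω, (if W b = W a then (1 : ℝ) else 0) * (fib W a)⁻¹ *
            ∑ ω : Ω, (if J ω = (Z₁ a, Z₂ b) then (fib J ω)⁻¹ else 0) := by
          rw [Finset.sum_comm]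
          refine Finset.sum_congr rfl fun a _ => ?_
          rw [Finset.sum_comm]
          simp_rw [Finset.mul_sum]
      _ ≤ ∑ a : Ω, ∑ b : Ω, (if W b = W a then (1 : ℝ) else 0) * (fib W a)⁻¹ * 1 := by
          gcongr with a _ b _
          · have hf := fib_pos W a
            positivity
          · refine le_of_eq_of_le ?_ (sum_inv_fib J (Z₁ a, Z₂ b))
            refine Finset.sum_congr rfl fun ω _ => ?_
            congr 1
      _ = ∑ a : Ω, 1 := by
          refine Finset.sum_congr rfl fun a _ => ?_
          simp_rw [mul_one]
          rw [← Finset.sum_mul]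
          exact mul_inv_cancel₀ (fib_pos W a).ne'
      _ = Fintype.card Ω := by simp
  have h3 : ∀ ω : Ω, Real.log (fib Z₁ ω) + Real.log (fib Z₂ ω) - Real.log (fib W ω)
      - Real.log (fib J ω) ≤ fib Z₁ ω * fib Z₂ ω * ((fib W ω)⁻¹ * (fib J ω)⁻¹) - 1 := by
    intro ω
    have a1 := fib_pos Z₁ ω
    have a2 := fib_pos Z₂ ω
    have a3 := fib_pos W ω
    have a4 := fib_pos J ω
    have := Real.log_le_sub_one_of_pos
      (x := fib Z₁ ω * fib Z₂ ω * ((fib W ω)⁻¹ * (fib J ω)⁻¹)) (by positivity)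
    rw [Real.log_mul (by positivity) (by positivity), Real.log_mul (by positivity) (by positivity),
      Real.log_mul (by positivity) (by positivity), Real.log_inv, Real.log_inv] at this
    linarith
  have h4 := Finset.sum_le_sum (s := Finset.univ) fun ω _ => h3 ω
  simp only [Finset.sum_sub_distrib, Finset.sum_add_distrib, Finset.sum_const,
    Finset.card_univ, nsmul_eq_mul, mul_one] at h4
  unfold ent
  rw [← mul_le_mul_iff_of_pos_left hc]
  simp only [mul_add, mul_sub, mul_div_cancel₀ _ hc.ne']
  linarith

theorem ent_pair_le {Ω S₁ S₂ : Type*} [Fintype Ω] [Nonempty Ω] (Z₁ : Ω → S₁) (Z₂ : Ω → S₂) :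
    ent (fun ω => (Z₁ ω, Z₂ ω)) ≤ ent Z₁ + ent Z₂ := by
  have := ent_submod Z₁ Z₂ (fun _ => ()) (by simp) (by simp)
  have h0 : ent (fun _ : Ω => ()) = 0 := by
    have hc : (0 : ℝ) < Fintype.card Ω := by exact_mod_cast Fintype.card_pos
    unfold ent fib
    simp
  linarith

theorem ent_ge {Ω S : Type*} [Fintype Ω] [Nonempty Ω] (Z : Ω → S) (c : ℝ)
    (h : ∀ ω, fib Z ω ≤ c) : Real.log (Fintype.card Ω) - Real.log c ≤ ent Z := by
  have hc : (0 : ℝ) < Fintype.card Ω := by exact_mod_cast Fintype.card_pos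
  unfold ent
  have : (∑ ω : Ω, Real.log (fib Z ω)) ≤ ∑ ω : Ω, Real.log c :=
    Finset.sum_le_sum fun ω _ => Real.log_le_log (fib_pos Z ω) (h ω)
  simp only [Finset.sum_const, Finset.card_univ, nsmul_eq_mul] at this
  have h2 : (∑ ω : Ω, Real.log (fib Z ω)) / (Fintype.card Ω) ≤ Real.log c := by
    rw [div_le_iff₀ hc]; linarith
  linarith

theorem ent_inj {Ω S : Type*} [Fintype Ω] [Nonempty Ω] (Z : Ω → S)
    (h : Function.Injective Z) : Real.log (Fintype.card Ω) ≤ ent Z := by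
  classical
  have := ent_ge Z 1 (fun ω => by unfold fib; simp [h.eq_iff])
  simpa using this

theorem ent_equiv {Ω S : Type*} [Fintype Ω] (Z : Ω → S) (e : Ω ≃ Ω) :
    ent (fun ω => Z (e ω)) = ent Z := by
  classical
  have : ∀ ω, fib (fun ω => Z (e ω)) ω = fib Z (e ω) := by
    intro ω
    unfold fib
    exact Equiv.sum_comp e (fun ω' => if Z ω' = Z (e ω) then (1 : ℝ) else 0)
  unfold ent
  simp_rw [this]
  rw [Equiv.sum_comp e (fun ω => Real.log (fib Z ω))]

/-- `ff S a = H(X - aY) - H(X)` for independent uniform X, Y on `S` -/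
noncomputable def ff {V : Type*} [AddCommGroup V] (S : Finset V) (a : ℕ) : ℝ :=
  ent (fun ω : S × S × S => (ω.1 : V) - a • (ω.2.1 : V)) - Real.log S.card

section
variable {V : Type*} [AddCommGroup V] (S : Finset V)

theorem log_card3 (hS : S.Nonempty) : Real.log (Fintype.card (S × S × S)) = 3 * Real.log S.card := by
  have : (0 : ℝ) < S.card := by exact_mod_cast Finset.card_pos.2 hS
  simp only [Fintype.card_prod, Fintype.card_coe]
  push_cast
  rw [Real.log_mul (by positivity) (by positivity), Real.log_mul (by positivity) (by positivity)]
  ring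

theorem ent_two (hS : S.Nonempty) (e : S × S × S → S × S) :
    ent e ≤ 2 * Real.log S.card := by
  have : (0 : ℝ) < S.card := by exact_mod_cast Finset.card_pos.2 hS
  have : Nonempty S := hS.to_subtype
  have h := ent_le_log e Finset.univ (by simp)
  simp only [Finset.card_univ, Fintype.card_prod, Fintype.card_coe] at h
  push_cast at h
  rw [Real.log_mul (by positivity) (by positivity)] at h
  linarith

theorem ent_one (hS : S.Nonempty) (e : S × S × S → S) :
    ent e ≤ Real.log S.card := by
  have : Nonempty S := hS.to_subtype
  have h := ent_le_log e Finset.univ (by simp)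
  simpa using h

/-- the rotation of coordinates -/
def rot (S : Finset V) : S × S × S ≃ S × S × S where
  toFun ω := (ω.2.1, ω.2.2, ω.1)
  invFun ω := (ω.2.2, ω.1, ω.2.1)
  left_inv _ := rfl
  right_inv _ := rfl

/-- swap of the last two coordinates -/
def swp (S : Finset V) : S × S × S ≃ S × S × S where
  toFun ω := (ω.1, ω.2.2, ω.2.1)
  invFun ω := (ω.1, ω.2.2, ω.2.1)
  left_inv _ := rfl
  right_inv _ := rfl

theorem ff_mul (hS : S.Nonempty) (a b : ℕ) : ff S (a * b) ≤ ff S a + ff S b := by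
  have : Nonempty S := hS.to_subtype

  have h := ent_submod (Ω := S × S × S)
    (fun ω => ((ω.1 : V) - a • (ω.2.1 : V), (ω.2.1 : V) - b • (ω.2.2 : V)))
    (fun ω => (ω.1, ω.2.2)) (fun ω => (ω.1 : V) - (a * b) • (ω.2.2 : V))
    (by
      intro ω ω' h
      simp only [Prod.mk.injEq] at h
      have e : ∀ x v y : V, x - (a * b) • y = (x - a • v) + a • (v - b • y) := by
        intro x v y; rw [smul_sub, mul_smul]; abel
      rw [e _ (ω.2.1 : V), e _ (ω'.2.1 : V), h.1, h.2])
    (by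
      intro ω ω' h
      simp only [Prod.mk.injEq] at h
      simp only [h.1, h.2])
  have hj := ent_inj (Ω := S × S × S) (fun ω =>
    (((ω.1 : V) - a • (ω.2.1 : V), (ω.2.1 : V) - b • (ω.2.2 : V)), (ω.1, ω.2.2)))
    (by
      rintro ⟨x, v, y⟩ ⟨x', v', y'⟩ h
      simp only [Prod.mk.injEq] at h
      obtain ⟨⟨h1, h2⟩, rfl, rfl⟩ := h
      simp only [sub_left_inj, SetLike.coe_eq_coe] at h2
      rw [h2])
  have hp := ent_pair_le (Ω := S × S × S) (fun ω => (ω.1 : V) - a • (ω.2.1 : V))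
    (fun ω => (ω.2.1 : V) - b • (ω.2.2 : V))
  have h2 := ent_two S hS (fun ω => (ω.1, ω.2.2))
  have e1 := ent_equiv (fun ω : S × S × S => (ω.1 : V) - b • (ω.2.1 : V)) (rot S)
  have e2 := ent_equiv (fun ω : S × S × S => (ω.1 : V) - (a * b) • (ω.2.1 : V)) (swp S)
  simp only [rot, swp, Equiv.coe_fn_mk] at e1 e2
  rw [log_card3 S hS] at hj
  unfold ff
  linarith

theorem ff_succ (hS : S.Nonempty) (a : ℕ) : ff S (a + 1) ≤ ff S a + 2 * ff S 1 := by
  have : Nonempty S := hS.to_subtype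

  have h := ent_submod (Ω := S × S × S)
    (fun ω => ((ω.1 : V) - (ω.2.1 : V) - (ω.2.2 : V), (ω.2.2 : V) - a • (ω.2.1 : V)))
    (fun ω => (ω.1, ω.2.1)) (fun ω => (ω.1 : V) - (a + 1) • (ω.2.1 : V))
    (by
      intro ω ω' h
      simp only [Prod.mk.injEq] at h
      have e : ∀ x y z : V, x - (a + 1) • y = (x - y - z) + (z - a • y) := by
        intro x y z; rw [add_smul, one_smul]; abel
      rw [e _ _ (ω.2.2 : V), e _ _ (ω'.2.2 : V), h.1, h.2])
    (by
      intro ω ω' h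
      simp only [Prod.mk.injEq] at h
      simp only [h.1, h.2])
  have hj := ent_inj (Ω := S × S × S) (fun ω =>
    (((ω.1 : V) - (ω.2.1 : V) - (ω.2.2 : V), (ω.2.2 : V) - a • (ω.2.1 : V)), (ω.1, ω.2.1)))
    (by
      rintro ⟨x, v, y⟩ ⟨x', v', y'⟩ h
      simp only [Prod.mk.injEq] at h
      obtain ⟨⟨h1, h2⟩, rfl, rfl⟩ := h
      simp only [sub_left_inj, SetLike.coe_eq_coe] at h2
      rw [h2])
  have hp := ent_pair_le (Ω := S × S × S) (fun ω => (ω.1 : V) - (ω.2.1 : V) - (ω.2.2 : V))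
    (fun ω => (ω.2.2 : V) - a • (ω.2.1 : V))
  have h2 := ent_two S hS (fun ω => (ω.1, ω.2.1))
  have e1 := ent_equiv (fun ω : S × S × S => (ω.1 : V) - a • (ω.2.1 : V))
    ((rot S).trans ((rot S).trans (swp S)))
  simp only [rot, swp, Equiv.coe_fn_mk, Equiv.trans_apply] at e1

  have g := ent_submod (Ω := S × S × S)
    (fun ω => ((ω.1 : V) - (ω.2.1 : V), ω.2.2))
    (fun ω => ((ω.1 : V) - (ω.2.2 : V), ω.2.1)) (fun ω => (ω.1 : V) - (ω.2.1 : V) - (ω.2.2 : V))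
    (by
      intro ω ω' h
      simp only [Prod.mk.injEq] at h
      simp only [h.1, h.2])
    (by
      intro ω ω' h
      simp only [Prod.mk.injEq] at h
      simp only [sub_right_comm _ (ω.2.1 : V), sub_right_comm _ (ω'.2.1 : V), h.1, h.2])
  have gj := ent_inj (Ω := S × S × S) (fun ω =>
    (((ω.1 : V) - (ω.2.1 : V), ω.2.2), ((ω.1 : V) - (ω.2.2 : V), ω.2.1)))
    (by
      rintro ⟨x, v, y⟩ ⟨x', v', y'⟩ h
      simp only [Prod.mk.injEq] at h
      obtain ⟨⟨h1, rfl⟩, h2, rfl⟩ := h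
      simp only [sub_left_inj, SetLike.coe_eq_coe] at h2
      rw [h2])
  have gp := ent_pair_le (Ω := S × S × S) (fun ω => (ω.1 : V) - (ω.2.1 : V)) (fun ω => ω.2.2)
  have gp2 := ent_pair_le (Ω := S × S × S) (fun ω => (ω.1 : V) - (ω.2.2 : V)) (fun ω => ω.2.1)
  have o1 := ent_one S hS (fun ω => ω.2.2)
  have o2 := ent_one S hS (fun ω => ω.2.1)
  have e2 := ent_equiv (fun ω : S × S × S => (ω.1 : V) - (ω.2.1 : V)) (swp S)
  simp only [swp, Equiv.coe_fn_mk] at e2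
  rw [log_card3 S hS] at hj gj
  unfold ff
  simp only [one_smul]
  linarith

theorem ff_one_nonneg (hS : S.Nonempty) : 0 ≤ ff S 1 := by
  have h := ff_mul S hS 1 1
  simp only [mul_one] at h
  linarith

theorem ff_lin (hS : S.Nonempty) (r : ℕ) (hr : 1 ≤ r) : ff S r ≤ (5 * r / 3) * ff S 1 := by
  have h0 := ff_one_nonneg S hS
  have h2 : ff S 2 ≤ 3 * ff S 1 := by have := ff_succ S hS 1; norm_num at this; linarith
  have h3 : ff S 3 ≤ 5 * ff S 1 := by have := ff_succ S hS 2; norm_num at this; linarith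
  induction r using Nat.strong_induction_on with
  | _ r ih =>
    rcases lt_or_ge r 4 with h4 | h4
    · interval_cases r
      · norm_num; linarith
      · norm_num; linarith
      · norm_num; linarith
    · obtain ⟨a, ha⟩ := Nat.even_or_odd' r
      have ha2 : 2 ≤ a := by omega
      have haR : (2 : ℝ) ≤ a := by exact_mod_cast ha2
      have iha := ih a (by omega) (by omega)
      have hm := ff_mul S hS 2 a
      rcases ha with rfl | rfl
      · push_cast; nlinarith
      · have hs := ff_succ S hS (2 * a)
        push_cast; nlinarith

theorem ff_log (hS : S.Nonempty) (r : ℕ) (hr : 1 ≤ r) :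
    ff S r ≤ (6 * (Nat.log 2 r : ℝ) + 2) * ff S 1 := by
  have h0 := ff_one_nonneg S hS
  have h2 : ff S 2 ≤ 3 * ff S 1 := by have := ff_succ S hS 1; norm_num at this; linarith
  induction r using Nat.strong_induction_on with
  | _ r ih =>
    rcases lt_or_ge r 2 with h4 | h4
    · interval_cases r
      norm_num; linarith
    · obtain ⟨a, ha⟩ := Nat.even_or_odd' r
      have ha2 : 1 ≤ a := by omega
      have iha := ih a (by omega) ha2
      have hm := ff_mul S hS 2 a
      have hl : Nat.log 2 r = Nat.log 2 a + 1 := by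
        rw [Nat.log_of_one_lt_of_le (by norm_num) h4]
        congr 2
        omega
      rw [hl]
      rcases ha with rfl | rfl
      · push_cast; nlinarith
      · have hs := ff_succ S hS (2 * a)
        push_cast; nlinarith

end

open scoped Classical in
/-- number of representations of `d` as a difference of elements of `Γ` -/
noncomputable def rep {V : Type*} [AddCommGroup V] (Γ : Finset V) (d : V) : ℝ :=
  ∑ c ∈ Γ, ∑ c' ∈ Γ, if c - c' = d then (1 : ℝ) else 0

theorem ff_one_le {V : Type*} [AddCommGroup V] (Γ S : Finset V) (hS : S.Nonempty) (hSΓ : Γ.Nonempty)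
    (hpos : ∀ x ∈ S, ∀ y ∈ S, 0 < rep Γ (x - y)) :
    ff S 1 ≤ 2 * Real.log Γ.card - (∑ x ∈ S, ∑ y ∈ S, Real.log (rep Γ (x - y))) / (S.card : ℝ) ^ 2
      - Real.log S.card := by
  classical
  have : Nonempty S := hS.to_subtype
  have hN : (0 : ℝ) < Γ.card := by exact_mod_cast Finset.card_pos.2 hSΓ
  have hn : (0 : ℝ) < S.card := by exact_mod_cast Finset.card_pos.2 hS
  have h := ent_gibbs (fun ω : S × S × S => (ω.1 : V) - (ω.2.1 : V))
    (Finset.univ.image (fun ω : S × S × S => (ω.1 : V) - (ω.2.1 : V)))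
    (fun ω => Finset.mem_image_of_mem _ (Finset.mem_univ ω)) (rep Γ)
    (fun s => by unfold rep; positivity) (fun ω => hpos _ ω.1.2 _ ω.2.1.2)
    ((Γ.card : ℝ) * Γ.card) (by positivity)
    (by
      unfold rep
      rw [Finset.sum_comm]
      calc _ ≤ ∑ c ∈ Γ, ∑ c' ∈ Γ, (1 : ℝ) := by
            refine Finset.sum_le_sum fun c _ => ?_
            rw [Finset.sum_comm]
            refine Finset.sum_le_sum fun c' _ => ?_
            rw [Finset.sum_ite_eq]
            split_ifs <;> norm_num
        _ = _ := by simp)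
  have e : (∑ ω : S × S × S, Real.log (rep Γ ((ω.1 : V) - (ω.2.1 : V)))) / (Fintype.card (S × S × S))
      = (∑ x ∈ S, ∑ y ∈ S, Real.log (rep Γ (x - y))) / (S.card : ℝ) ^ 2 := by
    rw [Fintype.sum_prod_type]
    simp_rw [Fintype.sum_prod_type]
    simp only [Finset.sum_const, Finset.card_univ, Fintype.card_coe, nsmul_eq_mul,
      Fintype.card_prod]
    simp_rw [← Finset.mul_sum]
    have : ∑ x ∈ S, ∑ y ∈ S, Real.log (rep Γ (x - y))
        = ∑ x : S, ∑ y : S, Real.log (rep Γ ((x : V) - (y : V))) := by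
      rw [← Finset.sum_coe_sort S]
      refine Finset.sum_congr rfl fun x _ => ?_
      rw [← Finset.sum_coe_sort S]
    rw [this]
    push_cast
    field_simp
  rw [e, Real.log_mul hN.ne' hN.ne'] at h
  unfold ff
  simp only [one_smul]
  linarith

theorem ff_lower {G H : Type*} [AddCommGroup G] [AddCommGroup H] (S : Finset (G × H))
    (hS : S.Nonempty) (h1 : Set.InjOn Prod.fst (S : Set (G × H)))
    (h2 : Set.InjOn Prod.snd (S : Set (G × H))) (r : ℕ) (R : Finset G) (hR : ∀ g : G, r • g ∈ R)
    (K : Finset H) (hK : ∀ h : H, r • h = 0 → h ∈ K) :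
    Real.log S.card ≤ Real.log R.card + Real.log K.card + ff S r := by
  classical
  have : Nonempty S := hS.to_subtype
  have hn : (0 : ℝ) < S.card := by exact_mod_cast Finset.card_pos.2 hS
  have hKpos : (0 : ℝ) < K.card := by exact_mod_cast Finset.card_pos.2 ⟨0, hK 0 (by simp)⟩
  have hp := ent_pair_le (Ω := S × S × S) (fun ω => (ω.1 : G × H) - r • (ω.2.1 : G × H))
    (fun ω => r • (ω.2.1 : G × H).1)
  have hr := ent_le_log (Ω := S × S × S) (fun ω => r • (ω.2.1 : G × H).1) R (fun ω => hR _)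
  have hl := ent_ge (Ω := S × S × S)
    (fun ω => ((ω.1 : G × H) - r • (ω.2.1 : G × H), r • (ω.2.1 : G × H).1))
    ((K.card : ℝ) * S.card) (by
      rintro ⟨x, y, z⟩
      have hfib : fib (fun ω : S × S × S =>
          ((ω.1 : G × H) - r • (ω.2.1 : G × H), r • (ω.2.1 : G × H).1)) (x, y, z)
          = ((Finset.univ.filter fun ω : S × S × S =>
          ((ω.1 : G × H) - r • (ω.2.1 : G × H), r • (ω.2.1 : G × H).1)
            = ((x : G × H) - r • (y : G × H), r • (y : G × H).1)).card : ℝ) := by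
        unfold fib
        rw [Finset.card_filter]
        push_cast
        refine Finset.sum_congr rfl fun ω _ => ?_
        congr 1
      rw [hfib]
      have : (Finset.univ.filter fun ω : S × S × S =>
          ((ω.1 : G × H) - r • (ω.2.1 : G × H), r • (ω.2.1 : G × H).1)
            = ((x : G × H) - r • (y : G × H), r • (y : G × H).1)).card
          ≤ (K ×ˢ (Finset.univ : Finset S)).card := by
        refine Finset.card_le_card_of_injOn
          (fun ω => ((ω.2.1 : G × H).2 - (y : G × H).2, ω.2.2)) ?_ ?_
        · rintro ⟨x', y', z'⟩ h
          simp only [Finset.coe_filter, Finset.mem_univ, true_and, Set.mem_ofPred_eq,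
            Prod.mk.injEq] at h
          have hx1 : (x' : G × H).1 = (x : G × H).1 := by
            have := congrArg Prod.fst h.1
            simp only [Prod.fst_sub, Prod.smul_fst, h.2] at this
            simpa using this
          have hx : (x' : G × H) = x := h1 x'.2 x.2 hx1
          have hy := congrArg Prod.snd h.1
          simp only [hx, Prod.snd_sub, Prod.smul_snd, sub_right_inj] at hy
          simp only [Finset.coe_product, Set.mem_prod, Finset.mem_coe, Finset.mem_univ, and_true]
          apply hK
          rw [smul_sub, hy, sub_self]
        · rintro ⟨x', y', z'⟩ h ⟨x'', y'', z''⟩ h' e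
          simp only [Finset.coe_filter, Finset.mem_univ, true_and, Set.mem_ofPred_eq,
            Prod.mk.injEq, sub_left_inj] at h h' e
          have hx1 : (x' : G × H).1 = (x : G × H).1 := by
            have := congrArg Prod.fst h.1
            simp only [Prod.fst_sub, Prod.smul_fst, h.2] at this
            simpa using this
          have hx2 : (x'' : G × H).1 = (x : G × H).1 := by
            have := congrArg Prod.fst h'.1
            simp only [Prod.fst_sub, Prod.smul_fst, h'.2] at this
            simpa using this
          have hx : x' = x'' := Subtype.ext (h1 x'.2 x''.2 (hx1.trans hx2.symm))
          have hy : y' = y'' := Subtype.ext (h2 y'.2 y''.2 e.1)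
          rw [hx, hy, e.2]
      rw [Finset.card_product, Finset.card_univ, Fintype.card_coe] at this
      exact_mod_cast this)
  rw [log_card3 S hS, Real.log_mul hKpos.ne' hn.ne'] at hl
  unfold ff
  linarith

open scoped Classical in
/-- the elements `a` of `Γ` with `a + b ∈ Γ` -/
noncomputable def sl {V : Type*} [AddCommGroup V] (Γ : Finset V) (b : V) : Finset V :=
  Γ.filter fun a => a + b ∈ Γ

open scoped Classical in
/-- number of `b ∈ Γ` with `x + b, y + b ∈ Γ` -/
noncomputable def cod {V : Type*} [AddCommGroup V] (Γ : Finset V) (x y : V) : ℝ :=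
  ∑ b ∈ Γ, if x ∈ sl Γ b ∧ y ∈ sl Γ b then (1 : ℝ) else 0

theorem sl_subset {V : Type*} [AddCommGroup V] (Γ : Finset V) (b : V) : sl Γ b ⊆ Γ := by
  classical
  intro a ha
  simp only [sl, Finset.mem_filter] at ha
  exact ha.1

theorem cod_le_rep {V : Type*} [AddCommGroup V] (Γ : Finset V) (x y : V) :
    cod Γ x y ≤ rep Γ (x - y) := by
  classical
  unfold cod rep
  rw [← Finset.sum_product' Γ Γ (fun c c' => if c - c' = x - y then (1 : ℝ) else 0)]
  rw [Finset.sum_boole, Finset.sum_boole]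
  norm_cast
  refine Finset.card_le_card_of_injOn (fun b => (x + b, y + b)) ?_ ?_
  · intro b hb
    simp only [Finset.coe_filter, Set.mem_ofPred_eq, sl, Finset.mem_filter] at hb
    simp [hb]
  · intro b _ b' _ h
    simpa using h

theorem cod_ge_one {V : Type*} [AddCommGroup V] (Γ : Finset V) (x y b : V) (hb : b ∈ Γ)
    (hx : x ∈ sl Γ b) (hy : y ∈ sl Γ b) : 1 ≤ cod Γ x y := by
  classical
  unfold cod
  have := Finset.single_le_sum (f := fun b => if x ∈ sl Γ b ∧ y ∈ sl Γ b then (1 : ℝ) else 0)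
    (fun i _ => by positivity) hb
  simpa [hx, hy] using this

theorem sum_inv_cod {V : Type*} [AddCommGroup V] (Γ : Finset V) :
    ∑ b ∈ Γ, ∑ x ∈ sl Γ b, ∑ y ∈ sl Γ b, (cod Γ x y)⁻¹ ≤ (Γ.card : ℝ) ^ 2 := by
  classical
  calc ∑ b ∈ Γ, ∑ x ∈ sl Γ b, ∑ y ∈ sl Γ b, (cod Γ x y)⁻¹
      = ∑ b ∈ Γ, ∑ x ∈ Γ, ∑ y ∈ Γ,
          (if x ∈ sl Γ b ∧ y ∈ sl Γ b then (1 : ℝ) else 0) * (cod Γ x y)⁻¹ := by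
        refine Finset.sum_congr rfl fun b _ => ?_
        have hs : sl Γ b = Γ.filter (fun a => a ∈ sl Γ b) := by
          ext a; simp only [sl, Finset.mem_filter]; tauto
        have e : ∀ g : V → ℝ, ∑ x ∈ sl Γ b, g x = ∑ x ∈ Γ, if x ∈ sl Γ b then g x else 0 := by
          intro g
          rw [← Finset.sum_filter, ← hs]
        rw [e]
        refine Finset.sum_congr rfl fun x _ => ?_
        rw [e]
        by_cases hx : x ∈ sl Γ b
        · simp only [hx, true_and, if_true]
          refine Finset.sum_congr rfl fun y _ => ?_
          split_ifs <;> simp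
        · simp [hx]
    _ = ∑ x ∈ Γ, ∑ y ∈ Γ, cod Γ x y * (cod Γ x y)⁻¹ := by
        rw [Finset.sum_comm]
        refine Finset.sum_congr rfl fun x _ => ?_
        rw [Finset.sum_comm]
        refine Finset.sum_congr rfl fun y _ => ?_
        rw [← Finset.sum_mul]
        rfl
    _ ≤ ∑ x ∈ Γ, ∑ y ∈ Γ, (1 : ℝ) := by
        refine Finset.sum_le_sum fun x _ => Finset.sum_le_sum fun y _ => ?_
        exact mul_inv_le_one
    _ = _ := by simp [sq]

theorem main_count {G H : Type*} [AddCommGroup G] [AddCommGroup H] (Γ : Finset (G × H))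
    (hΓ : Γ.Nonempty) (h1 : Set.InjOn Prod.fst (Γ : Set (G × H)))
    (h2 : Set.InjOn Prod.snd (Γ : Set (G × H))) (r : ℕ) (R : Finset G) (hR : ∀ g : G, r • g ∈ R)
    (K : Finset H) (hK : ∀ h : H, r • h = 0 → h ∈ K) (m : ℝ) (hm : 0 ≤ m)
    (hf : ∀ S : Finset (G × H), S.Nonempty → ff S r ≤ m * ff S 1)
    (T : ℝ) (hT : T = ∑ b ∈ Γ, ((sl Γ b).card : ℝ)) (hTpos : 0 < T) :
    Real.log Γ.card + (3 * m + 1) * Real.log (T / (Γ.card : ℝ) ^ 2)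
      ≤ Real.log R.card + Real.log K.card := by
  have hN : (0 : ℝ) < Γ.card := by exact_mod_cast Finset.card_pos.2 hΓ
  set N : ℝ := (Γ.card : ℝ) with hNdef
  set M : ℝ := Real.log R.card + Real.log K.card with hM
  set L := Real.log N with hL
  set D := Real.log (T / N ^ 2) with hD
  set n : G × H → ℝ := fun b => ((sl Γ b).card : ℝ) with hn
  set u := T / N with hu
  set v := T ^ 2 / N ^ 3 with hv
  have hu0 : 0 < u := by positivity
  have hv0 : 0 < v := by positivity
  have lu : Real.log u = L + D := by
    rw [hL, hD, ← Real.log_mul (by positivity) (by positivity)]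
    congr 1; rw [hu]; field_simp
  have lv : Real.log v = L + 2 * D := by
    have : Real.log v = Real.log N + Real.log ((T / N ^ 2) ^ 2) := by
      rw [← Real.log_mul (by positivity) (by positivity)]
      congr 1; rw [hv]; field_simp
    rw [this, Real.log_pow]; push_cast; ring
  have hlog : ∀ w x : ℝ, 0 < w → 0 < x → Real.log w + 1 - w * x⁻¹ ≤ Real.log x := by
    intro w x hw hx
    have := Real.log_le_sub_one_of_pos (x := w * x⁻¹) (by positivity)
    rw [Real.log_mul hw.ne' (by positivity), Real.log_inv] at this
    linarith
  have hb : ∀ b ∈ Γ, (m + 1) * (n b ^ 2 * (L + D + 1) - u * n b)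
      + m * (n b ^ 2 * (L + 2 * D + 1) - v * ∑ x ∈ sl Γ b, ∑ y ∈ sl Γ b, (cod Γ x y)⁻¹)
      ≤ n b ^ 2 * (M + 2 * m * L) := by
    intro b hb
    rcases (sl Γ b).eq_empty_or_nonempty with he | hne
    · have : n b = 0 := by simp [hn, he]
      rw [this, he]; simp
    · have hnb : 0 < n b := by
        simp only [hn]; exact_mod_cast Finset.card_pos.2 hne
      have hsub : (sl Γ b : Set (G × H)) ⊆ Γ := by
        intro a ha
        simp only [sl, Finset.coe_filter, Set.mem_ofPred_eq] at ha
        exact ha.1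
      have low := ff_lower (sl Γ b) hne (h1.mono hsub) (h2.mono hsub) r R hR K hK
      have up := ff_one_le Γ (sl Γ b) hne hΓ (fun x hx y hy =>
        lt_of_lt_of_le one_pos ((cod_ge_one Γ x y b hb hx hy).trans (cod_le_rep Γ x y)))
      have hff := hf _ hne
      have hup : m * ff (sl Γ b) 1 ≤ m * (2 * L - (∑ x ∈ sl Γ b, ∑ y ∈ sl Γ b,
          Real.log (rep Γ (x - y))) / n b ^ 2 - Real.log (n b)) :=
        mul_le_mul_of_nonneg_left up hm
      set Q := ∑ x ∈ sl Γ b, ∑ y ∈ sl Γ b, Real.log (rep Γ (x - y)) with hQ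
      have hQlow : n b ^ 2 * (L + 2 * D + 1) - v * ∑ x ∈ sl Γ b, ∑ y ∈ sl Γ b, (cod Γ x y)⁻¹
          ≤ Q := by
        have : ∑ x ∈ sl Γ b, ∑ y ∈ sl Γ b, (L + 2 * D + 1 - v * (cod Γ x y)⁻¹) ≤ Q := by
          refine Finset.sum_le_sum fun x hx => Finset.sum_le_sum fun y hy => ?_
          have hc := cod_ge_one Γ x y b hb hx hy
          have := hlog v (cod Γ x y) hv0 (by linarith)
          rw [lv] at this
          exact this.trans (Real.log_le_log (by linarith) (cod_le_rep Γ x y))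
        simp only [Finset.sum_sub_distrib, Finset.sum_const, ← Finset.mul_sum,
          nsmul_eq_mul] at this
        have e : n b = ((sl Γ b).card : ℝ) := rfl
        rw [e]
        linarith
      have hnl : n b ^ 2 * (L + D + 1) - u * n b ≤ n b ^ 2 * Real.log (n b) := by
        have := mul_le_mul_of_nonneg_left (hlog u (n b) hu0 hnb) (sq_nonneg (n b))
        rw [lu] at this
        have e : n b ^ 2 * (L + D + 1 - u * (n b)⁻¹) = n b ^ 2 * (L + D + 1) - u * n b := by
          field_simp
        linarith
      have tot : (m + 1) * Real.log (n b) + m * (Q / n b ^ 2) ≤ M + 2 * m * L := by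
        have e : Real.log (n b) = Real.log ((sl Γ b).card : ℝ) := rfl
        rw [← e] at low
        linarith
      have tot2 := mul_le_mul_of_nonneg_left tot (sq_nonneg (n b))
      have e : n b ^ 2 * ((m + 1) * Real.log (n b) + m * (Q / n b ^ 2))
          = (m + 1) * (n b ^ 2 * Real.log (n b)) + m * Q := by
        field_simp
      have a1 := mul_le_mul_of_nonneg_left hnl (by linarith : 0 ≤ m + 1)
      have a2 := mul_le_mul_of_nonneg_left hQlow hm
      linarith
  have hsum := Finset.sum_le_sum hb
  set E := ∑ b ∈ Γ, n b ^ 2 with hE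
  have hTn : ∑ b ∈ Γ, n b = T := hT.symm
  simp only [Finset.sum_add_distrib, ← Finset.mul_sum, Finset.sum_sub_distrib,
    ← Finset.sum_mul] at hsum
  rw [hTn, ← hE] at hsum
  have hcod := mul_le_mul_of_nonneg_left (sum_inv_cod Γ) hv0.le
  have hCS : T ^ 2 ≤ N * E := by
    rw [← hTn]; exact sq_sum_le_card_mul_sum_sq
  have hE0 : 0 < E := by
    by_contra h
    push Not at h
    nlinarith [sq_pos_of_pos hTpos]
  have hv2 : v * N ^ 2 = T ^ 2 / N := by rw [hv]; field_simp
  have hu2 : u * T = T ^ 2 / N := by rw [hu]; field_simp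
  have hCS' : T ^ 2 / N ≤ E := by rw [div_le_iff₀ hN]; linarith
  rw [← hNdef, hv2] at hcod
  rw [hu2] at hsum
  have b1 := mul_le_mul_of_nonneg_left hcod hm
  have b2 := mul_le_mul_of_nonneg_left hCS' (by linarith : 0 ≤ 2 * m + 1)
  have fin : E * (L + (3 * m + 1) * D) ≤ E * M := by nlinarith
  exact le_of_mul_le_mul_left fin hE0

theorem final_step (N T M m α : ℝ) (hN : 0 < N) (hT0 : 0 ≤ T) (hT : T ≤ N ^ 2) (hM : 0 < M)
    (hm : 0 ≤ m) (hα0 : 0 < α) (hα : α ≤ 1 / (3 * m + 1))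
    (h : M < N → 0 < T → Real.log N + (3 * m + 1) * Real.log (T / N ^ 2) ≤ Real.log M) :
    T / N ^ 2 ≤ (M / N) ^ α := by
  rcases hT0.eq_or_lt with h0 | hTpos
  · rw [← h0]; simp only [zero_div]; positivity
  rcases le_or_gt N M with hNM | hMN
  · calc T / N ^ 2 ≤ 1 := by rw [div_le_one (by positivity)]; exact hT
      _ ≤ _ := Real.one_le_rpow (by rw [le_div_iff₀ hN]; linarith) hα0.le
  · have h' := h hMN hTpos
    rw [← Real.log_le_log_iff (by positivity) (by positivity), Real.log_rpow (by positivity),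
      Real.log_div hM.ne' hN.ne']
    have hlt : Real.log M < Real.log N := Real.log_lt_log hM hMN
    have hp : 0 < 3 * m + 1 := by linarith
    have s1 : Real.log (T / N ^ 2) ≤ (1 / (3 * m + 1)) * (Real.log M - Real.log N) := by
      rw [one_div, inv_mul_eq_div, le_div_iff₀ hp]; linarith
    have s2 : (1 / (3 * m + 1)) * (Real.log M - Real.log N) ≤ α * (Real.log M - Real.log N) :=
      mul_le_mul_of_nonpos_right hα (by linarith)
    linarith


theorem stmt_11 :
    ∃ C : ℝ, 0 < C ∧
      ∀ (G H : Type) [AddCommGroup G] [AddCommGroup H] [Fintype G]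
        (Γ : Set (G × H)), Γ.Finite →
        Set.InjOn Prod.fst Γ → Set.InjOn Prod.snd Γ →
        ∀ r : ℕ, ({h : H | r • h = 0}).Finite →
          ∀ α : ℝ, 0 < α →
            α ≤ max (1 / (5 * (r : ℝ) + 1)) (1 / (18 * (Nat.log 2 r : ℝ) + 7)) →
            (Nat.card {t : (G × H) × (G × H) × (G × H) //
                t.1 ∈ Γ ∧ t.2.1 ∈ Γ ∧ t.2.2 ∈ Γ ∧ t.1 + t.2.1 = t.2.2} : ℝ)
                / (Nat.card Γ : ℝ) ^ 2
              ≤ (C * (Nat.card (Set.range (fun g : G => r • g)) : ℝ)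
                    * (Nat.card {h : H | r • h = 0} : ℝ) / (Nat.card Γ : ℝ)) ^ α := by
  refine ⟨1, one_pos, ?_⟩
  intro G H _ _ _ Γ hfin h1 h2 r hK α hα0 hα
  classical
  obtain ⟨Γ, rfl⟩ := hfin.exists_finset_coe
  rcases Γ.eq_empty_or_nonempty with rfl | hΓ
  · simp [Real.zero_rpow hα0.ne']
  have hcard : Nat.card {t : (G × H) × (G × H) × (G × H) //
      t.1 ∈ (Γ : Set (G × H)) ∧ t.2.1 ∈ (Γ : Set (G × H)) ∧ t.2.2 ∈ (Γ : Set (G × H)) ∧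
        t.1 + t.2.1 = t.2.2} = ∑ b ∈ Γ, (sl Γ b).card := by
    rw [← Finset.card_sigma, ← Nat.card_eq_finsetCard]
    refine Nat.card_congr
      { toFun := fun t => ⟨⟨t.1.2.1, t.1.1⟩, ?_⟩
        invFun := fun p => ⟨(p.1.2, p.1.1, p.1.2 + p.1.1), ?_⟩
        left_inv := ?_
        right_inv := ?_ }
    · obtain ⟨t, ha, hb, hc, e⟩ := t
      simp only [Finset.mem_coe] at ha hb hc
      simp only [Finset.mem_sigma, sl, Finset.mem_filter]
      exact ⟨hb, ha, by rw [e]; exact hc⟩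
    · obtain ⟨p, hp⟩ := p
      simp only [Finset.mem_sigma, sl, Finset.mem_filter] at hp
      exact ⟨hp.2.1, hp.1, hp.2.2, rfl⟩
    · rintro ⟨⟨a, b, c⟩, ha, hb, hc, e⟩
      simp only at e
      simp [e]
    · rintro ⟨⟨b, a⟩, hp⟩
      rfl
  have hΓc : Nat.card (Γ : Set (G × H)) = Γ.card := by simp
  obtain ⟨R, hRm, hRc⟩ : ∃ R : Finset G, (∀ g : G, r • g ∈ R) ∧
      Nat.card (Set.range (fun g : G => r • g)) = R.card :=
    ⟨(Set.finite_range (fun g : G => r • g)).toFinset,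
      fun g => (Set.Finite.mem_toFinset _).2 (Set.mem_range_self g),
      Nat.card_eq_card_finite_toFinset _⟩
  obtain ⟨K, hKm, hKc⟩ : ∃ K : Finset H, (∀ h : H, r • h = 0 → h ∈ K) ∧
      Nat.card {h : H | r • h = 0} = K.card :=
    ⟨hK.toFinset, fun h hh => (Set.Finite.mem_toFinset _).2 hh,
      Nat.card_eq_card_finite_toFinset _⟩
  rw [hcard, hΓc, hRc, hKc, one_mul]
  have hRpos : (0 : ℝ) < R.card := by
    exact_mod_cast Finset.card_pos.2 ⟨r • (0 : G), hRm 0⟩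
  have hKpos : (0 : ℝ) < K.card := by
    exact_mod_cast Finset.card_pos.2 ⟨(0 : H), hKm 0 (smul_zero r)⟩
  have hNpos : (0 : ℝ) < Γ.card := by exact_mod_cast Finset.card_pos.2 hΓ
  have hTle : ((∑ b ∈ Γ, (sl Γ b).card : ℕ) : ℝ) ≤ (Γ.card : ℝ) ^ 2 := by
    have : ∑ b ∈ Γ, (sl Γ b).card ≤ ∑ b ∈ Γ, Γ.card :=
      Finset.sum_le_sum fun b _ => Finset.card_le_card (sl_subset Γ b)
    rw [Finset.sum_const, smul_eq_mul, ← sq] at this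
    exact_mod_cast this
  have main : ∀ m : ℝ, 0 ≤ m → α ≤ 1 / (3 * m + 1) →
      (∀ S : Finset (G × H), S.Nonempty → 1 ≤ r → ff S r ≤ m * ff S 1) →
      ((∑ b ∈ Γ, (sl Γ b).card : ℕ) : ℝ) / (Γ.card : ℝ) ^ 2
        ≤ ((R.card : ℝ) * K.card / Γ.card) ^ α := by
    intro m hm hαm hf
    refine final_step (Γ.card : ℝ) _ ((R.card : ℝ) * K.card) m α hNpos (by positivity) hTle (by positivity) hm hα0 hαm ?_
    intro hMN hT
    have hr : 1 ≤ r := by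
      by_contra hr
      have hr0 : r = 0 := by omega
      have hle : Γ.card ≤ K.card :=
        Finset.card_le_card_of_injOn Prod.snd (fun x _ => hKm _ (by rw [hr0, zero_smul])) h2
      have hle' : (Γ.card : ℝ) ≤ K.card := by exact_mod_cast hle
      have hR1 : (1 : ℝ) ≤ R.card := by exact_mod_cast (by exact_mod_cast hRpos : 0 < R.card)
      nlinarith
    rw [Real.log_mul hRpos.ne' hKpos.ne']
    exact main_count Γ hΓ h1 h2 r R hRm K hKm m hm (fun S hS => hf S hS hr) _ (by push_cast; rfl) hT
  rcases le_max_iff.1 hα with h | h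
  · refine main (5 * r / 3) (by positivity) ?_ (fun S hS hr => ff_lin S hS r hr)
    rwa [show 3 * (5 * (r : ℝ) / 3) + 1 = 5 * (r : ℝ) + 1 by ring]
  · refine main (6 * (Nat.log 2 r : ℝ) + 2) (by positivity) ?_ (fun S hS hr => ff_log S hS r hr)
    rwa [show 3 * (6 * (Nat.log 2 r : ℝ) + 2) + 1 = 18 * (Nat.log 2 r : ℝ) + 7 by ring]
end
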